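/- arXiv:math/0303359 — 4 statements merged into one kernel-verified Lean document; each statement's English description precedes it below -/
import Mathlib

section
/- Let H be a finite-dimensional Hopf algebra over ℂ, let (P, π) be a projective cover of the trivial H-module, and let V₁, …, V_N be pairwise non-isomorphic finite-dimensional simple H-modules. Then N · dim(P) ≤ dim(H). -/
open Coalgebra TensorProduct

section HopfIdentity

variable {H : Type*} [Ring H] [HopfAlgebra ℂ H]

/-- In Sweedler notation, `S(h₁) h₂ ⊗ h₃ = 1 ⊗ h`. -/
theorem sum_antipode_tmul_one_mul_comul (h : H) :
    ∑ i ∈ (ℛ ℂ h).index,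
      (HopfAlgebra.antipode ℂ ((ℛ ℂ h).left i) ⊗ₜ[ℂ] (1 : H)) * comul ((ℛ ℂ h).right i) =
    (1 : H) ⊗ₜ[ℂ] h := by
  have key := congrArg ((LinearMap.mul' ℂ H).rTensor H ∘ₗ
    (TensorProduct.assoc ℂ H H H).symm.toLinearMap ∘ₗ
    (HopfAlgebra.antipode ℂ (A := H)).rTensor (H ⊗[ℂ] H))
    (sum_tmul_tmul_eq (ℛ ℂ h) (fun i => ℛ ℂ ((ℛ ℂ h).left i)) (fun i => ℛ ℂ ((ℛ ℂ h).right i)))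
  simp only [map_sum, LinearMap.comp_apply, LinearMap.rTensor_tmul, LinearEquiv.coe_coe,
    TensorProduct.assoc_symm_tmul, LinearMap.mul'_apply] at key
  calc _ = _ := ?_
    _ = _ := key.symm
    _ = _ := ?_
  · refine Finset.sum_congr rfl fun i _ => ?_
    conv_lhs => rw [← (ℛ ℂ ((ℛ ℂ h).right i)).eq, Finset.mul_sum]
    simp only [Algebra.TensorProduct.tmul_mul_tmul, one_mul]
  · simp only [← TensorProduct.sum_tmul, HopfAlgebra.sum_antipode_mul_eq_smul,
      TensorProduct.smul_tmul]
    rw [← TensorProduct.tmul_sum, sum_counit_smul]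

variable {P : Type*} [AddCommGroup P] [Module ℂ P] [Module H P] [IsScalarTower ℂ H P]

/-- The linear map `a ⊗ b ↦ A(a) • b • p`. -/
noncomputable def contractAction (p : P) (A : H →ₗ[ℂ] ℂ) : H ⊗[ℂ] H →ₗ[ℂ] P :=
  (TensorProduct.lid ℂ P).toLinearMap ∘ₗ
    TensorProduct.map A ((LinearMap.toSpanSingleton H P p).restrictScalars ℂ)

@[simp]
theorem contractAction_tmul (p : P) (A : H →ₗ[ℂ] ℂ) (a b : H) :
    contractAction p A (a ⊗ₜ b) = A a • b • p := by
  simp [contractAction]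

theorem contractAction_add (p : P) (A B : H →ₗ[ℂ] ℂ) :
    contractAction p (A + B) = contractAction p A + contractAction p B := by
  ext a b
  simp [add_smul]

theorem contractAction_smul (p : P) (c : ℂ) (A : H →ₗ[ℂ] ℂ) :
    contractAction p (c • A) = c • contractAction p A := by
  ext a b
  simp [mul_smul]

theorem contractAction_tmul_one_mul (p : P) (A : H →ₗ[ℂ] ℂ) (s : H) (t : H ⊗[ℂ] H) :
    contractAction p A ((s ⊗ₜ 1) * t) = contractAction p (A ∘ₗ LinearMap.mulLeft ℂ s) t := by
  induction t with
  | zero => simp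
  | tmul a b => simp
  | add x y hx hy => rw [mul_add, map_add, map_add, hx, hy]

theorem contractAction_one_tmul_mul (p : P) (A : H →ₗ[ℂ] ℂ) (h : H) (t : H ⊗[ℂ] H) :
    contractAction p A ((1 ⊗ₜ h) * t) = h • contractAction p A t := by
  induction t with
  | zero => simp
  | tmul a b =>
    rw [Algebra.TensorProduct.tmul_mul_tmul, one_mul, contractAction_tmul, contractAction_tmul,
      mul_smul, smul_comm]
  | add x y hx hy => rw [mul_add, map_add, map_add, hx, hy, smul_add]

theorem smul_contractAction_comul (p : P) (A : H →ₗ[ℂ] ℂ) (h x : H) :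
    h • contractAction p A (comul x) =
      ∑ i ∈ (ℛ ℂ h).index,
        contractAction p
          (A ∘ₗ LinearMap.mulLeft ℂ (HopfAlgebra.antipode ℂ ((ℛ ℂ h).left i)))
          (comul ((ℛ ℂ h).right i * x)) := by
  rw [← contractAction_one_tmul_mul, ← sum_antipode_tmul_one_mul_comul, Finset.sum_mul, map_sum]
  refine Finset.sum_congr rfl fun i _ => ?_
  rw [mul_assoc, contractAction_tmul_one_mul, Bialgebra.comul_mul]

theorem map_contractAction_comul [Module H ℂ]
    (hTriv : ∀ (x : H) (c : ℂ), x • c = counit (R := ℂ) x * c)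
    (π : P →ₗ[H] ℂ) (p : P) (hp : π p = 1) (A : H →ₗ[ℂ] ℂ) (x : H) :
    π (contractAction p A (comul x)) = A x := by
  have hsmul (c : ℂ) (q : P) : π (c • q) = c * π q := by
    rw [← algebraMap_smul H c q, map_smul, hTriv, Bialgebra.counit_algebraMap]
  rw [← (ℛ ℂ x).eq, map_sum, map_sum]
  simp only [contractAction_tmul, hsmul, map_smul, hTriv, hp, mul_one]
  have h2 := congrArg (fun t => TensorProduct.lid ℂ ℂ (A.rTensor ℂ t))
    (sum_tmul_counit_eq (R := ℂ) (ℛ ℂ x))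
  simpa only [map_sum, LinearMap.rTensor_tmul, TensorProduct.lid_tmul, smul_eq_mul, mul_one]
    using h2

end HopfIdentity

/-- A finite power of a superfluous submodule is superfluous. -/
theorem eq_top_of_pi_superfluous {R P : Type*} [Ring R] [AddCommGroup P] [Module R P]
    (K : Submodule R P) (hK : ∀ N : Submodule R P, N ⊔ K = ⊤ → N = ⊤)
    {ι : Type*} [Fintype ι] [DecidableEq ι] (U : Submodule R (ι → P))
    (hU : ∀ q : ι → P, ∃ u ∈ U, ∀ i, q i - u i ∈ K) : U = ⊤ := by
  have step (s : Finset ι) :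
      U ⊔ s.sup (fun i => K.map (LinearMap.single R (fun _ => P) i)) = ⊤ → U = ⊤ := by
    induction s using Finset.induction_on with
    | empty => simp
    | insert j s _ ih =>
      intro h
      apply ih
      rw [Finset.sup_insert, sup_left_comm, sup_comm] at h
      set W := U ⊔ s.sup (fun i => K.map (LinearMap.single R (fun _ => P) i))
      have hc : W.comap (LinearMap.single R (fun _ => P) j) = ⊤ := by
        apply hK
        rw [eq_top_iff]
        intro q _
        have hq : LinearMap.single R (fun _ => P) j q ∈
            W ⊔ K.map (LinearMap.single R (fun _ => P) j) := h ▸ Submodule.mem_top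
        obtain ⟨w, hw, z, hz, hwz⟩ := Submodule.mem_sup.mp hq
        obtain ⟨k, hk, rfl⟩ := hz
        refine Submodule.mem_sup.mpr ⟨q - k, ?_, k, hk, sub_add_cancel q k⟩
        rw [Submodule.mem_comap, map_sub, ← hwz, add_sub_cancel_right]
        exact hw
      rw [← h, left_eq_sup, Submodule.map_le_iff_le_comap, hc]
      exact le_top
  refine step Finset.univ (eq_top_iff.mpr fun q _ => ?_)
  obtain ⟨u, hu, hq⟩ := hU q
  refine Submodule.mem_sup.mpr ⟨u, hu, q - u, ?_, add_sub_cancel u q⟩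
  rw [← Finset.univ_sum_single (q - u)]
  refine Submodule.sum_mem _ fun i _ => ?_
  exact (Finset.le_sup (f := fun i => K.map (LinearMap.single R (fun _ => P) i))
    (Finset.mem_univ i)) ⟨_, hq i, rfl⟩

/-- If a left ideal (a module `L` with a map to `H`) contains an element acting as the identity on
a nonzero module `V`, then its dimension is at least that of the projective cover of the
trivial module. -/
theorem finrank_cover_le_of_acts_as_one {H : Type*} [Ring H] [HopfAlgebra ℂ H] [Module H ℂ]
    (hTriv : ∀ (x : H) (c : ℂ), x • c = counit (R := ℂ) x * c)
    {P : Type*} [AddCommGroup P] [Module ℂ P] [Module H P] [IsScalarTower ℂ H P]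
    (π : P →ₗ[H] ℂ) (hπ : Function.Surjective π)
    (hsup : ∀ N : Submodule H P, N ⊔ LinearMap.ker π = ⊤ → N = ⊤)
    {V : Type*} [AddCommGroup V] [Module ℂ V] [Module H V] [IsScalarTower ℂ H V]
    [FiniteDimensional ℂ V] [Nontrivial V]
    {L : Type*} [AddCommGroup L] [Module ℂ L] [Module H L] [IsScalarTower ℂ H L]
    [FiniteDimensional ℂ L] (ι : L →ₗ[H] H) (e : L) (he : ∀ v : V, ι e • v = v) :
    Module.finrank ℂ P ≤ Module.finrank ℂ L := by
  classical
  obtain ⟨p, hp⟩ := hπ 1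
  let b := Module.finBasis ℂ V
  let A (j : Fin (Module.finrank ℂ V)) (f : Module.Dual ℂ V) : H →ₗ[ℂ] ℂ :=
    f ∘ₗ (LinearMap.toSpanSingleton H V (b j)).restrictScalars ℂ
  let Φ : Module.Dual ℂ V ⊗[ℂ] L →ₗ[ℂ] (Fin (Module.finrank ℂ V) → P) :=
    TensorProduct.lift (LinearMap.mk₂ ℂ
      (fun f x j => contractAction p (A j f) (comul (ι x)))
      (fun f g x => by
        ext j
        simp [A, LinearMap.add_comp, contractAction_add])
      (fun c f x => by
        ext j
        simp [A, LinearMap.smul_comp, contractAction_smul])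
      (fun f x y => by
        ext j
        simp)
      (fun c f x => by
        ext j
        simp [LinearMap.map_smul_of_tower]))
  have hΦ (f x j) : Φ (f ⊗ₜ x) j = contractAction p (A j f) (comul (ι x)) := by
    simp [Φ]
  let U : Submodule H (Fin (Module.finrank ℂ V) → P) :=
    { LinearMap.range Φ with
      smul_mem' := by
        rintro h _ ⟨t, rfl⟩
        change h • Φ t ∈ LinearMap.range Φ
        induction t with
        | zero => simp
        | add x y hx hy =>
          rw [map_add, smul_add]
          exact add_mem hx hy
        | tmul f x =>
          refine ⟨∑ i ∈ (ℛ ℂ h).index,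
            (f ∘ₗ (Algebra.lsmul ℂ ℂ V (HopfAlgebra.antipode ℂ ((ℛ ℂ h).left i)))) ⊗ₜ
              ((ℛ ℂ h).right i • x), ?_⟩
          ext j
          rw [map_sum, Finset.sum_apply, Pi.smul_apply, hΦ, smul_contractAction_comul]
          refine Finset.sum_congr rfl fun i _ => ?_
          rw [hΦ, map_smul, smul_eq_mul]
          congr 1
          congr 1
          ext y
          simp [A, mul_smul] }
  have hU : U = ⊤ := by
    refine eq_top_of_pi_superfluous (LinearMap.ker π) hsup U fun q => ?_
    let f : Module.Dual ℂ V := b.constr ℂ fun j => π (q j)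
    refine ⟨Φ (f ⊗ₜ e), ⟨_, rfl⟩, fun j => ?_⟩
    rw [LinearMap.mem_ker, map_sub, hΦ, map_contractAction_comul hTriv π p hp]
    simp [A, he, f]
  have hsurj : Function.Surjective Φ := fun q => by
    have : q ∈ U := hU ▸ Submodule.mem_top
    exact this
  have : Module.Finite ℂ (Fin (Module.finrank ℂ V) → P) := Module.Finite.of_surjective Φ hsurj
  have hpos : 0 < Module.finrank ℂ V := Module.finrank_pos
  have : Module.Finite ℂ P :=
    Module.Finite.of_surjective
      (LinearMap.proj (R := ℂ) (φ := fun _ : Fin (Module.finrank ℂ V) => P) ⟨0, hpos⟩)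
      (Function.surjective_eval _)
  have hle := LinearMap.finrank_le_finrank_of_surjective hsurj
  rw [Module.finrank_pi_fintype, Finset.sum_const, Finset.card_univ, Fintype.card_fin, smul_eq_mul,
    Module.finrank_tensorProduct, Subspace.dual_finrank_eq] at hle
  exact Nat.le_of_mul_le_mul_left hle hpos

/-- Density: the ring acts on finitely many pairwise non-isomorphic simple modules through
elements separating them. -/
theorem exists_acts_as_ite {H : Type*} [Ring H] [Algebra ℂ H]
    {N : ℕ} {V : Fin N → Type*}
    [∀ i, AddCommGroup (V i)] [∀ i, Module ℂ (V i)] [∀ i, Module H (V i)]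
    [∀ i, IsScalarTower ℂ H (V i)] [∀ i, FiniteDimensional ℂ (V i)]
    (hsimple : ∀ i, IsSimpleModule H (V i))
    (hdistinct : ∀ i j, i ≠ j → IsEmpty ((V i) ≃ₗ[H] (V j))) (i : Fin N) :
    ∃ a : H, ∀ j (v : V j), a • v = if j = i then v else 0 := by
  let f : Module.End (Module.End H (∀ i, V i)) (∀ i, V i) :=
    { toFun := fun w => Pi.single i (w i)
      map_add' := fun x y => by simp [Pi.single_add]
      map_smul' := fun φ w => by
        have hzero (j k : Fin N) (hjk : j ≠ k) (v : V j) : φ (Pi.single j v) k = 0 := by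
          let g : V j →ₗ[H] V k := LinearMap.proj k ∘ₗ φ ∘ₗ LinearMap.single H V j
          rcases LinearMap.bijective_or_eq_zero g with hg | hg
          · exact ((hdistinct j k hjk).false (LinearEquiv.ofBijective g hg)).elim
          · exact LinearMap.congr_fun hg v
        change Pi.single i (φ w i) = φ (Pi.single i (w i))
        have hw : φ w i = φ (Pi.single i (w i)) i := by
          conv_lhs => rw [← Finset.univ_sum_single w, map_sum, Finset.sum_apply]
          exact Finset.sum_eq_single i (fun j _ hj => hzero j i hj _) (by simp)
        ext k
        by_cases hk : k = i
        · subst hk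
          simpa using hw
        · rw [Pi.single_eq_of_ne hk, hzero i k (Ne.symm hk)] }
  obtain ⟨s, hs⟩ := (inferInstance : Module.Finite ℂ (∀ i, V i)).fg_top
  obtain ⟨a, ha⟩ := jacobson_density f s
  have hall (w : ∀ i, V i) : a • w = Pi.single i (w i) := by
    induction hs.ge (Submodule.mem_top : w ∈ ⊤) using Submodule.span_induction with
    | mem w hw => exact (ha w hw).symm
    | zero => simp
    | add x y _ _ hx hy => simp [smul_add, hx, hy, Pi.single_add]
    | smul c x _ hx => rw [smul_comm, hx, Pi.smul_apply, Pi.single_smul]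
  refine ⟨a, fun j v => ?_⟩
  have h := congrFun (hall (Pi.single j v)) j
  rw [Pi.smul_apply, Pi.single_eq_same] at h
  rw [h]
  split_ifs with hj
  · subst hj
    simp
  · rw [Pi.single_eq_of_ne hj]

/-- If a left ideal `L = H g`, `g` idempotent, acts through `g` as the identity on each of the
modules `V j`, `j ∈ s`, and `H` separates these modules, then `dim L ≥ |s| * dim P`. -/
theorem card_mul_finrank_cover_le {H : Type*} [Ring H] [HopfAlgebra ℂ H] [Module H ℂ]
    (hTriv : ∀ (x : H) (c : ℂ), x • c = counit (R := ℂ) x * c)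
    {P : Type*} [AddCommGroup P] [Module ℂ P] [Module H P] [IsScalarTower ℂ H P]
    (π : P →ₗ[H] ℂ) (hπ : Function.Surjective π)
    (hsup : ∀ N : Submodule H P, N ⊔ LinearMap.ker π = ⊤ → N = ⊤)
    {I : Type*} {V : I → Type*}
    [∀ i, AddCommGroup (V i)] [∀ i, Module ℂ (V i)] [∀ i, Module H (V i)]
    [∀ i, IsScalarTower ℂ H (V i)] [∀ i, FiniteDimensional ℂ (V i)] [∀ i, Nontrivial (V i)]
    [DecidableEq I]
    (hsep : ∀ i, ∃ a : H, ∀ j (v : V j), a • v = if j = i then v else 0)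
    (s : Finset I) {L : Type*} [AddCommGroup L] [Module ℂ L] [Module H L] [IsScalarTower ℂ H L]
    [FiniteDimensional ℂ L] (ι : L →ₗ[H] H) (g : L) (hg : ∀ x : L, ι x • g = x)
    (hone : ∀ j ∈ s, ∀ v : V j, ι g • v = v) :
    s.card * Module.finrank ℂ P ≤ Module.finrank ℂ L := by
  induction s using Finset.induction_on generalizing L with
  | empty => simp
  | insert i s his ih =>
    obtain ⟨a, ha⟩ := hsep i
    let f : Module.End H L := (LinearMap.toSpanSingleton H L (a • g)) ∘ₗ ι
    have hf (x : L) : f x = ι x • a • g := rfl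
    have hact (x : L) {j : I} (hj : j ∈ insert i s) (v : V j) :
        ι (f x) • v = if j = i then ι x • v else 0 := by
      rw [hf, map_smul, map_smul, smul_eq_mul, smul_eq_mul, mul_smul, mul_smul, hone j hj, ha]
      split_ifs <;> simp
    have : IsNoetherian H L := isNoetherian_of_tower ℂ inferInstance
    have : IsArtinian H L := isArtinian_of_tower ℂ inferInstance
    obtain ⟨n, hn, hcompl⟩ :=
      ((Filter.eventually_ge_atTop 1).and
        (LinearMap.eventually_isCompl_ker_pow_range_pow f)).exists
    have hpow_self (m : ℕ) (x : L) (v : V i) : ι ((f ^ m) x) • v = ι x • v := by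
      induction m with
      | zero => simp
      | succ m ihm => rw [pow_succ', Module.End.mul_apply, hact _ (by simp), if_pos rfl, ihm]
    have hpow_ne (x : L) {j : I} (hj : j ∈ s) (v : V j) : ι ((f ^ n) x) • v = 0 := by
      obtain ⟨m, rfl⟩ := Nat.exists_eq_add_of_le' hn
      rw [pow_succ', Module.End.mul_apply, hact _ (Finset.mem_insert_of_mem hj),
        if_neg (ne_of_mem_of_not_mem hj his)]
    have hfin (M : Submodule H L) : FiniteDimensional ℂ M :=
      inferInstanceAs (FiniteDimensional ℂ (M.restrictScalars ℂ))
    have := hfin (LinearMap.ker (f ^ n))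
    have := hfin (LinearMap.range (f ^ n))
    obtain ⟨k, hk, e, he, hke⟩ := Submodule.mem_sup.mp
      (hcompl.sup_eq_top ▸ Submodule.mem_top : g ∈ LinearMap.ker (f ^ n) ⊔ LinearMap.range (f ^ n))
    have hrange : Module.finrank ℂ P ≤ Module.finrank ℂ (LinearMap.range (f ^ n)) := by
      refine finrank_cover_le_of_acts_as_one hTriv π hπ hsup (V := V i)
        (ι ∘ₗ (LinearMap.range (f ^ n)).subtype) ⟨e, he⟩ fun v => ?_
      have hkv : ι k • v = 0 := by
        rw [← hpow_self n k v, LinearMap.mem_ker.mp hk, map_zero, zero_smul]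
      have hgv := hone i (Finset.mem_insert_self i s) v
      rwa [← hke, map_add, add_smul, hkv, zero_add] at hgv
    have hker : s.card * Module.finrank ℂ P ≤ Module.finrank ℂ (LinearMap.ker (f ^ n)) := by
      refine ih (ι ∘ₗ (LinearMap.ker (f ^ n)).subtype) ⟨k, hk⟩ (fun x => ?_) fun j hj v => ?_
      · have hx := hg x.1
        rw [← hke, smul_add] at hx
        have h1 : ι x.1 • e ∈ LinearMap.ker (f ^ n) := by
          rw [← eq_sub_iff_add_eq'] at hx
          rw [hx]
          exact Submodule.sub_mem _ x.2 (Submodule.smul_mem _ _ hk)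
        have h2 := Submodule.disjoint_def.mp hcompl.disjoint _ h1 (Submodule.smul_mem _ _ he)
        rw [h2, add_zero] at hx
        exact Subtype.ext hx
      · obtain ⟨y, rfl⟩ := he
        have hgv := hone j (Finset.mem_insert_of_mem hj) v
        rwa [← hke, map_add, add_smul, hpow_ne y hj, add_zero] at hgv
    have hadd := LinearMap.finrank_range_add_finrank_ker ((f ^ n).restrictScalars ℂ)
    rw [Finset.card_insert_of_notMem his, add_mul, one_mul, ← hadd, add_comm]
    exact add_le_add hrange hker

/-- If `P` is a projective cover of the trivial module of a finite-dimensional Hopf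
algebra `H` over `ℂ` and `V₁, …, V_N` are pairwise non-isomorphic finite-dimensional
simple `H`-modules, then `N · dim P ≤ dim H`. -/
theorem num_simples_mul_dim_projective_cover_le
    (H : Type) [Ring H] [HopfAlgebra ℂ H] [FiniteDimensional ℂ H]
    -- the trivial H-module: ℂ with H acting through the counit
    [Module H ℂ]
    (hTriv : ∀ (x : H) (c : ℂ), x • c = Coalgebra.counit (R := ℂ) x * c)
    -- (P, π) is a projective cover of the trivial module
    (P : Type) [AddCommGroup P] [Module ℂ P] [Module H P] [IsScalarTower ℂ H P]
    (hP : Module.Projective H P)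
    (π : P →ₗ[H] ℂ) (hπ : Function.Surjective π)
    (hsup : ∀ N : Submodule H P, N ⊔ LinearMap.ker π = ⊤ → N = ⊤)
    -- pairwise non-isomorphic finite-dimensional simple modules V₁, …, V_N
    (N : ℕ) (V : Fin N → Type)
    [∀ i, AddCommGroup (V i)] [∀ i, Module ℂ (V i)] [∀ i, Module H (V i)]
    [∀ i, IsScalarTower ℂ H (V i)]
    (hsimple : ∀ i, IsSimpleModule H (V i))
    (hfd : ∀ i, FiniteDimensional ℂ (V i))
    (hdistinct : ∀ i j, i ≠ j → IsEmpty ((V i) ≃ₗ[H] (V j))) :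
    N * Module.finrank ℂ P ≤ Module.finrank ℂ H := by
  classical
  have hnt : ∀ i, Nontrivial (V i) := fun i => IsSimpleModule.nontrivial H (V i)
  have hle := card_mul_finrank_cover_le hTriv π hπ hsup (exists_acts_as_ite hsimple hdistinct)
    Finset.univ (LinearMap.id : H →ₗ[H] H) 1 (fun x => by simp) (fun j _ v => by simp)
  simpa using hle
end

section
/- Let H be a finite-dimensional Hopf algebra over ℂ, let (P, π) be a projective cover of the trivial H-module, let V be a finite-dimensional simple H-module, and let (P_V, π_V) be a projective cover of V. Then dim(P) ≤ dim(V) · dim(P_V). -/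
open scoped TensorProduct Coalgebra

namespace HopfAlgebra

section General

variable {R M N : Type*} [Ring R] [AddCommGroup M] [Module R M] [AddCommGroup N] [Module R N]

/-- A submodule that surjects onto the target of a map with superfluous kernel is everything. -/
theorem eq_top_of_map_eq_top {f : M →ₗ[R] N}
    (hf : ∀ K : Submodule R M, K ⊔ LinearMap.ker f = ⊤ → K = ⊤)
    {K : Submodule R M} (hK : K.map f = ⊤) : K = ⊤ := by
  apply hf
  rw [← Submodule.comap_map_eq, hK, Submodule.comap_top]

/-- The source of a surjection onto a simple module with superfluous kernel is cyclic. -/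
theorem finite_of_superfluous_ker_of_isSimpleModule [IsSimpleModule R N] {f : M →ₗ[R] N}
    (hsurj : Function.Surjective f)
    (hf : ∀ K : Submodule R M, K ⊔ LinearMap.ker f = ⊤ → K = ⊤) : Module.Finite R M := by
  have := IsSimpleModule.nontrivial R N
  obtain ⟨y, hy⟩ := exists_ne (0 : N)
  obtain ⟨x, rfl⟩ := hsurj y
  refine ⟨⟨{x}, eq_top_of_map_eq_top hf ?_⟩⟩
  rw [Finset.coe_singleton, Submodule.map_span, Set.image_singleton]
  exact IsSimpleModule.span_singleton_eq_top R hy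

end General

variable {k H : Type*} [Field k] [Ring H]

/-- A projective module lifts against an equivariant linear surjection whose source carries its
action in the form of an algebra homomorphism to the endomorphism ring. -/
theorem exists_equivariant_lift [Algebra k H] {W V Q : Type*} [AddCommGroup W] [Module k W]
    [AddCommGroup V] [Module k V] [Module H V]
    [AddCommGroup Q] [Module k Q] [Module H Q] [IsScalarTower k H Q] [Module.Projective H Q]
    (ρ : H →ₐ[k] Module.End k W) (q : W →ₗ[k] V) (hq : Function.Surjective q)
    (hqρ : ∀ h w, q (ρ h w) = h • q w) (g : Q →ₗ[H] V) :
    ∃ φ : Q →ₗ[k] W, (∀ h x, φ (h • x) = ρ h (φ x)) ∧ ∀ x, q (φ x) = g x := by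
  let _ : Module H W := Module.compHom W (ρ : H →+* Module.End k W)
  have smul_def (h : H) (w : W) : h • w = ρ h w := rfl
  let q' : W →ₗ[H] V := { toFun := q, map_add' := map_add q, map_smul' := hqρ }
  obtain ⟨φ, hφ⟩ := Module.projective_lifting_property q' g hq
  refine ⟨{ toFun := φ, map_add' := map_add φ, map_smul' := fun c x ↦ ?_ },
    fun h x ↦ map_smul φ h x, fun x ↦ LinearMap.congr_fun hφ x⟩
  rw [← algebraMap_smul H c x, map_smul, smul_def, AlgHom.commutes]
  rfl

section Bialgebra

variable [Bialgebra k H]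
  (V P : Type*) [AddCommGroup V] [Module k V] [Module H V] [IsScalarTower k H V]
  [AddCommGroup P] [Module k P] [Module H P] [IsScalarTower k H P]

/-- The diagonal action of a bialgebra on the tensor product of two modules. -/
noncomputable def diagonalAction : H →ₐ[k] Module.End k (V ⊗[k] P) :=
  (Module.endTensorEndAlgHom.comp
    (Algebra.TensorProduct.map (Algebra.lsmul k k V) (Algebra.lsmul k k P))).comp
      (Bialgebra.comulAlgHom k H)

variable {V P}

theorem diagonalAction_tmul {ι : Type*} {h : H} (r : Coalgebra.Repr k h ι) (v : V) (p : P) :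
    diagonalAction V P h (v ⊗ₜ[k] p) =
      ∑ i ∈ r.index, (r.left i • v) ⊗ₜ[k] (r.right i • p) := by
  simp [diagonalAction, ← r.eq, LinearMap.sum_apply, Module.endTensorEndAlgHom_apply]

/-- Applying a functional that is equivariant for the counit to the second factor of a tensor
product is equivariant for the diagonal action. -/
theorem rid_lTensor_diagonalAction {α : P →ₗ[k] k}
    (hα : ∀ (h : H) p, α (h • p) = Coalgebra.counit (R := k) h * α p) (h : H) (t : V ⊗[k] P) :
    TensorProduct.rid k V (α.lTensor V (diagonalAction V P h t)) =
      h • TensorProduct.rid k V (α.lTensor V t) := by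
  induction t with
  | zero => simp
  | add x y hx hy => simp only [map_add, hx, hy, smul_add]
  | tmul v p =>
    have key : ∑ i ∈ (ℛ k h).index,
        Coalgebra.counit (R := k) ((ℛ k h).right i) • (ℛ k h).left i = h := by
      simpa only [map_sum, TensorProduct.rid_tmul, one_smul] using
        congr(TensorProduct.rid k H $(Coalgebra.sum_tmul_counit_eq (ℛ k h)))
    rw [diagonalAction_tmul (ℛ k h)]
    simp only [map_sum, LinearMap.lTensor_tmul, TensorProduct.rid_tmul, hα]
    conv_rhs => rw [← key, Finset.sum_smul]
    refine Finset.sum_congr rfl fun i _ ↦ ?_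
    rw [smul_assoc, smul_comm ((ℛ k h).left i) (α p) v, smul_smul]

end Bialgebra

section Hopf

variable [HopfAlgebra k H]
  {V P Q : Type*} [AddCommGroup V] [Module k V] [Module H V] [IsScalarTower k H V]
  [AddCommGroup P] [Module k P] [Module H P] [IsScalarTower k H P]

/-- Contracting the first tensor factor with a functional is compatible with the action, once the
functional is acted upon through the antipode. -/
theorem smul_lid_rTensor {ι : Type*} {h : H} (r : Coalgebra.Repr k h ι) (f : Module.Dual k V)
    (t : V ⊗[k] P) :
    h • TensorProduct.lid k P (f.rTensor P t) =
      ∑ i ∈ r.index, TensorProduct.lid k P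
        ((f ∘ₗ Algebra.lsmul k k V (antipode k (r.left i))).rTensor P
          (diagonalAction V P (r.right i) t)) := by
  induction t with
  | zero => simp
  | add x y hx hy => simp only [map_add, smul_add, hx, hy, Finset.sum_add_distrib]
  | tmul v p =>
    let ev : H →ₗ[k] k := f ∘ₗ (LinearMap.toSpanSingleton H V v).restrictScalars k
    let act : H →ₗ[k] P := (LinearMap.toSpanSingleton H P p).restrictScalars k
    let B : H ⊗[k] (H ⊗[k] H) →ₗ[k] P :=
      TensorProduct.lid k P ∘ₗ TensorProduct.map
        (ev ∘ₗ LinearMap.mul' k H ∘ₗ (antipode k).rTensor H) act ∘ₗ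
          (TensorProduct.assoc k H H H).symm
    have hB (a b c : H) : B (a ⊗ₜ (b ⊗ₜ c)) = f ((antipode k a * b) • v) • c • p := by
      simp [B, ev, act]
    have hsum := congr(B $(Coalgebra.sum_tmul_tmul_eq r (fun i ↦ ℛ k (r.left i))
      (fun i ↦ ℛ k (r.right i))))
    simp only [map_sum, hB] at hsum
    simp only [diagonalAction_tmul (ℛ k _), map_sum, LinearMap.rTensor_tmul,
      TensorProduct.lid_tmul, LinearMap.comp_apply, Algebra.lsmul_coe, ← mul_smul]
    simp only [mul_smul] at hsum ⊢
    rw [← hsum]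
    simp only [← Finset.sum_smul, ← map_sum, ← mul_smul, sum_antipode_mul_eq_smul]
    simp only [smul_assoc, one_smul, map_smul, smul_eq_mul]
    conv_lhs => rw [← Coalgebra.sum_counit_smul r]
    simp only [Finset.sum_smul, smul_assoc, mul_smul]
    refine Finset.sum_congr rfl fun i _ ↦ ?_
    rw [smul_comm (r.right i) (f v) p]

/-- If `V` is a nonzero quotient of a projective module `Q`, and `P` maps onto the trivial module
in such a way that no proper submodule of `P` has nonzero image, then `dim P ≤ dim V * dim Q`. -/
theorem finrank_le_of_superfluous_ker [AddCommGroup Q] [Module k Q] [Module H Q]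
    [IsScalarTower k H Q] [Module.Projective H Q] [FiniteDimensional k V] [FiniteDimensional k Q]
    [Nontrivial V] {α : P →ₗ[k] k}
    (hα : ∀ (h : H) p, α (h • p) = Coalgebra.counit (R := k) h * α p)
    (hα0 : Function.Surjective α)
    (hsup : ∀ N : Submodule H P, (∃ p ∈ N, α p ≠ 0) → N = ⊤)
    (g : Q →ₗ[H] V) (hg : Function.Surjective g) :
    Module.finrank k P ≤ Module.finrank k V * Module.finrank k Q := by
  obtain ⟨φ, hφ, hφg⟩ := exists_equivariant_lift (diagonalAction V P)
    ((TensorProduct.rid k V).toLinearMap ∘ₗ α.lTensor V)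
    ((TensorProduct.rid k V).surjective.comp (LinearMap.lTensor_surjective V hα0))
    (rid_lTensor_diagonalAction hα) g
  let Ψ : Module.Dual k V ⊗[k] Q →ₗ[k] P :=
    TensorProduct.lift ((LinearMap.llcomp k Q (V ⊗[k] P) P).flip φ ∘ₗ
      LinearMap.llcomp k (V ⊗[k] P) (k ⊗[k] P) P (TensorProduct.lid k P).toLinearMap ∘ₗ
        LinearMap.rTensorHom P)
  have hΨ (f : Module.Dual k V) (x : Q) :
      Ψ (f ⊗ₜ x) = TensorProduct.lid k P (f.rTensor P (φ x)) := by
    simp [Ψ]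
  let N : Submodule H P :=
    { LinearMap.range Ψ with
      smul_mem' := by
        rintro h _ ⟨t, rfl⟩
        change h • Ψ t ∈ LinearMap.range Ψ
        induction t with
        | zero => simp
        | add x y hx hy => rw [map_add, smul_add]; exact add_mem hx hy
        | tmul f x =>
          rw [hΨ, smul_lid_rTensor (ℛ k h)]
          refine sum_mem fun i _ ↦ ?_
          rw [← hφ, ← hΨ]
          exact LinearMap.mem_range_self _ _ }
  have hN : N = ⊤ := by
    obtain ⟨v, hv⟩ := exists_ne (0 : V)
    obtain ⟨x, rfl⟩ := hg v
    obtain ⟨f, hf⟩ : ∃ f : Module.Dual k V, f (g x) ≠ 0 := by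
      by_contra! h
      exact hv ((Module.forall_dual_apply_eq_zero_iff k _).mp h)
    refine hsup N ⟨Ψ (f ⊗ₜ x), LinearMap.mem_range_self _ _, ?_⟩
    have swap (t : V ⊗[k] P) : α (TensorProduct.lid k P (f.rTensor P t)) =
        f (TensorProduct.rid k V (α.lTensor V t)) := by
      induction t with
      | zero => simp
      | add x y hx hy => simp only [map_add, hx, hy]
      | tmul v p => simp [mul_comm]
    have hx := hφg x
    rw [LinearMap.comp_apply, LinearEquiv.coe_coe] at hx
    rwa [hΨ, swap, hx]
  have hrange : LinearMap.range Ψ = ⊤ :=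
    SetLike.coe_injective congr(($hN : Set P))
  calc Module.finrank k P = Module.finrank k (LinearMap.range Ψ) := by rw [hrange, finrank_top]
    _ ≤ Module.finrank k (Module.Dual k V ⊗[k] Q) := LinearMap.finrank_range_le Ψ
    _ = Module.finrank k V * Module.finrank k Q := by
      rw [Module.finrank_tensorProduct, Subspace.dual_finrank_eq]

end Hopf

end HopfAlgebra


/-- If `(P, π)` is a projective cover of the trivial module of a finite-dimensional
Hopf algebra `H` over `ℂ`, `V` is a finite-dimensional simple `H`-module, and
`(P_V, π_V)` is a projective cover of `V`, then `dim P ≤ dim V · dim P_V`. -/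
theorem dim_projective_cover_trivial_le
    (H : Type) [Ring H] [HopfAlgebra ℂ H] [FiniteDimensional ℂ H]
    -- the trivial H-module: ℂ with H acting through the counit
    [Module H ℂ]
    (hTriv : ∀ (x : H) (c : ℂ), x • c = Coalgebra.counit (R := ℂ) x * c)
    -- (P, π) is a projective cover of the trivial module
    (P : Type) [AddCommGroup P] [Module ℂ P] [Module H P] [IsScalarTower ℂ H P]
    (hP : Module.Projective H P)
    (π : P →ₗ[H] ℂ) (hπ : Function.Surjective π)
    (hsup : ∀ N : Submodule H P, N ⊔ LinearMap.ker π = ⊤ → N = ⊤)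
    -- V is a finite-dimensional simple H-module
    (V : Type) [AddCommGroup V] [Module ℂ V] [Module H V] [IsScalarTower ℂ H V]
    (hsimple : IsSimpleModule H V) (hfd : FiniteDimensional ℂ V)
    -- (P_V, π_V) is a projective cover of V
    (PV : Type) [AddCommGroup PV] [Module ℂ PV] [Module H PV] [IsScalarTower ℂ H PV]
    (hPV : Module.Projective H PV)
    (πV : PV →ₗ[H] V) (hπV : Function.Surjective πV)
    (hsupV : ∀ N : Submodule H PV, N ⊔ LinearMap.ker πV = ⊤ → N = ⊤) :
    Module.finrank ℂ P ≤ Module.finrank ℂ V * Module.finrank ℂ PV := by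
  let α : P →ₗ[ℂ] ℂ :=
    { toFun := π
      map_add' := map_add π
      map_smul' := fun c p ↦ by
        rw [← algebraMap_smul H c p, map_smul, hTriv, Bialgebra.counit_algebraMap]
        rfl }
  have := IsSimpleModule.nontrivial H V
  have := HopfAlgebra.finite_of_superfluous_ker_of_isSimpleModule hπV hsupV
  have := Module.Finite.trans (R := ℂ) H PV
  refine HopfAlgebra.finrank_le_of_superfluous_ker (α := α)
    (fun h p ↦ (map_smul π h p).trans (hTriv h (π p))) hπ (fun N ⟨p, hpN, hp⟩ ↦ ?_) πV hπV
  refine HopfAlgebra.eq_top_of_map_eq_top hsup (eq_top_iff.mpr fun c _ ↦ ?_)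
  refine ⟨algebraMap ℂ H (c / π p) • p, N.smul_mem _ hpN, ?_⟩
  rw [map_smul, hTriv, Bialgebra.counit_algebraMap]
  exact div_mul_cancel₀ c hp
end

section
/- Let H be a finite-dimensional Hopf algebra over ℂ. If the trivial H-module is a projective H-module, then H is semisimple as a ring. -/
open scoped TensorProduct

namespace HopfAlgebra

open Coalgebra

variable {k H : Type*} [Field k] [Ring H] [HopfAlgebra k H]

/-- The element `∑ Λ₁ ⊗ S(Λ₂)` of `H ⊗ H` attached to `Λ`. -/
noncomputable def casimir (k : Type*) {H : Type*} [Field k] [Ring H] [HopfAlgebra k H] (Λ : H) :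
    H ⊗[k] H :=
  (antipode k).lTensor H (comul (R := k) Λ)

/-- The linear map `a ⊗ y ↦ (a ⊗ 1) * t * (1 ⊗ y)`. -/
noncomputable def sandwich (t : H ⊗[k] H) : H ⊗[k] H →ₗ[k] H ⊗[k] H :=
  TensorProduct.lift <| LinearMap.mk₂ k (fun a y ↦ (a ⊗ₜ[k] 1) * t * ((1 : H) ⊗ₜ[k] y))
    (fun a a' y ↦ by rw [TensorProduct.add_tmul, add_mul, add_mul])
    (fun c a y ↦ by rw [← TensorProduct.smul_tmul', smul_mul_assoc, smul_mul_assoc])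
    (fun a y y' ↦ by rw [TensorProduct.tmul_add, mul_add])
    (fun c a y ↦ by rw [TensorProduct.tmul_smul, mul_smul_comm])

@[simp]
lemma sandwich_tmul (t : H ⊗[k] H) (a y : H) :
    sandwich t (a ⊗ₜ[k] y) = (a ⊗ₜ[k] 1) * t * ((1 : H) ⊗ₜ[k] y) := rfl

lemma lTensor_antipode_tmul_mul (a b : H) (t : H ⊗[k] H) :
    (antipode k).lTensor H ((a ⊗ₜ[k] b) * t) =
      (a ⊗ₜ[k] 1) * (antipode k).lTensor H t * ((1 : H) ⊗ₜ[k] antipode k b) := by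
  induction t with
  | zero => simp
  | add x y hx hy => simp only [mul_add, map_add, hx, hy, add_mul]
  | tmul p q => simp [antipode_mul_antidistrib]

lemma sandwich_assoc_tmul (t w : H ⊗[k] H) (x : H) :
    sandwich ((antipode k).lTensor H t)
      ((LinearMap.mul' k H ∘ₗ (antipode k).rTensor H).lTensor H
        (TensorProduct.assoc k H H H (w ⊗ₜ[k] x))) =
      (antipode k).lTensor H (w * t) * ((1 : H) ⊗ₜ[k] x) := by
  induction w with
  | zero => simp
  | add u v hu hv => simp only [TensorProduct.add_tmul, map_add, hu, hv, add_mul]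
  | tmul a b => simp [lTensor_antipode_tmul_mul, mul_assoc]

/-- For a left integral `Λ`, the element `∑ Λ₁ ⊗ S(Λ₂)` is a Casimir element. -/
lemma tmul_one_mul_casimir {Λ : H} (hΛ : ∀ x : H, x * Λ = counit (R := k) x • Λ) (h : H) :
    (h ⊗ₜ[k] 1) * casimir k Λ = casimir k Λ * ((1 : H) ⊗ₜ[k] h) := by
  have left_eq (u : H ⊗[k] H) :
      sandwich (casimir k Λ) ((LinearMap.mul' k H ∘ₗ (antipode k).rTensor H).lTensor H
        ((comul (R := k)).lTensor H u)) =
      (TensorProduct.rid k H ((counit (R := k)).lTensor H u) ⊗ₜ[k] 1) * casimir k Λ := by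
    induction u with
    | zero => simp
    | add u v hu hv => simp only [map_add, TensorProduct.add_tmul, add_mul, hu, hv]
    | tmul a b =>
      simp only [LinearMap.lTensor_tmul, LinearMap.comp_apply, mul_antipode_rTensor_comul_apply,
        Algebra.algebraMap_eq_smul_one, TensorProduct.rid_tmul, TensorProduct.tmul_smul,
        ← TensorProduct.smul_tmul', map_smul, smul_mul_assoc]
      rw [sandwich_tmul, ← Algebra.TensorProduct.one_def, mul_one]
  have right_eq (u : H ⊗[k] H) :
      sandwich (casimir k Λ) ((LinearMap.mul' k H ∘ₗ (antipode k).rTensor H).lTensor H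
        (TensorProduct.assoc k H H H ((comul (R := k)).rTensor H u))) =
      casimir k Λ * ((1 : H) ⊗ₜ[k] TensorProduct.lid k H ((counit (R := k)).rTensor H u)) := by
    induction u with
    | zero => simp
    | add u v hu hv => simp only [map_add, TensorProduct.tmul_add, mul_add, hu, hv]
    | tmul a b =>
      rw [LinearMap.rTensor_tmul, casimir, sandwich_assoc_tmul, ← Bialgebra.comul_mul, hΛ]
      simp
  have key := right_eq (comul h)
  rw [coassoc_apply, left_eq] at key
  simpa using key

variable {M : Type*} [AddCommGroup M] [Module k M] [Module H M] [IsScalarTower k H M]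

/-- The linear map `a ⊗ b ↦ a • p (b • m)`. -/
noncomputable def averageAux (p : M →ₗ[k] M) (m : M) : H ⊗[k] H →ₗ[k] M :=
  TensorProduct.lift <| LinearMap.mk₂ k (fun a b : H ↦ a • p (b • m))
    (fun a a' b ↦ add_smul _ _ _)
    (fun c a b ↦ smul_assoc _ _ _)
    (fun a b b' ↦ by rw [add_smul, map_add, smul_add])
    (fun c a b ↦ by
      have := IsScalarTower.to_smulCommClass (R := k) (A := H) (M := M)
      rw [smul_assoc, map_smul, smul_comm])

@[simp]
lemma averageAux_tmul (p : M →ₗ[k] M) (m : M) (a b : H) :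
    averageAux p m (a ⊗ₜ[k] b) = a • p (b • m) := rfl

lemma averageAux_add (p : M →ₗ[k] M) (m m' : M) (t : H ⊗[k] H) :
    averageAux p (m + m') t = averageAux p m t + averageAux p m' t := by
  induction t with
  | zero => simp
  | add u v hu hv => simp only [map_add, hu, hv]; abel
  | tmul a b => simp

lemma averageAux_tmul_one_mul (p : M →ₗ[k] M) (m : M) (h : H) (t : H ⊗[k] H) :
    averageAux p m ((h ⊗ₜ[k] 1) * t) = h • averageAux p m t := by
  induction t with
  | zero => simp
  | add u v hu hv => simp only [map_add, mul_add, smul_add, hu, hv]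
  | tmul a b => simp [mul_smul]

lemma averageAux_mul_one_tmul (p : M →ₗ[k] M) (m : M) (h : H) (t : H ⊗[k] H) :
    averageAux p m (t * ((1 : H) ⊗ₜ[k] h)) = averageAux p (h • m) t := by
  induction t with
  | zero => simp
  | add u v hu hv => simp only [map_add, add_mul, hu, hv]
  | tmul a b => simp [mul_smul]

lemma averageAux_mem {p : M →ₗ[k] M} {N : Submodule H M} (hp : ∀ m, p m ∈ N) (m : M)
    (t : H ⊗[k] H) : averageAux p m t ∈ N := by
  induction t with
  | zero => simp
  | add u v hu hv => rw [map_add]; exact N.add_mem hu hv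
  | tmul a b => exact N.smul_mem _ (hp _)

lemma averageAux_of_mem {p : M →ₗ[k] M} {N : Submodule H M} (hp : ∀ m ∈ N, p m = m) {m : M}
    (hm : m ∈ N) (t : H ⊗[k] H) : averageAux p m t = LinearMap.mul' k H t • m := by
  induction t with
  | zero => simp
  | add u v hu hv => simp only [map_add, add_smul, hu, hv]
  | tmul a b => simp [hp _ (N.smul_mem b hm), mul_smul]

/-- **Maschke's theorem** for Hopf algebras: a left integral of counit `1` makes every module
semisimple. -/
theorem isSemisimpleModule_of_integral {Λ : H} (hΛ : ∀ x : H, x * Λ = counit (R := k) x • Λ)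
    (hcounit : counit (R := k) Λ = 1) : IsSemisimpleModule H M where
  exists_isCompl N := by
    obtain ⟨q, hq⟩ := (N.restrictScalars k).subtype.exists_leftInverse_of_injective
      (Submodule.ker_subtype _)
    let p : M →ₗ[k] M := (N.restrictScalars k).subtype ∘ₗ q
    have hpN (m : M) : p m ∈ N := (q m).2
    have hp (m : M) (hm : m ∈ N) : p m = m :=
      congrArg Subtype.val (LinearMap.congr_fun hq ⟨m, hm⟩)
    let π : M →ₗ[H] N :=
      { toFun m := ⟨averageAux p m (casimir k Λ), averageAux_mem hpN m _⟩
        map_add' m m' := Subtype.ext (averageAux_add p m m' _)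
        map_smul' h m := Subtype.ext <| by
          simp only [RingHom.id_apply, Submodule.coe_smul]
          rw [← averageAux_tmul_one_mul, tmul_one_mul_casimir hΛ, averageAux_mul_one_tmul] }
    refine ⟨LinearMap.ker π, LinearMap.isCompl_of_proj (f := π) fun m ↦ Subtype.ext ?_⟩
    change averageAux p (m : M) (casimir k Λ) = m
    rw [averageAux_of_mem hp m.2, casimir, mul_antipode_lTensor_comul_apply, hcounit, map_one,
      one_smul]

end HopfAlgebra

/-- If the trivial module (ℂ with `H` acting through the counit) is projective,
then the finite-dimensional Hopf algebra `H` is semisimple. -/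
theorem trivial_module_projective_implies_semisimple
    (H : Type) [Ring H] [HopfAlgebra ℂ H] [FiniteDimensional ℂ H]
    [Module H ℂ]
    (hTriv : ∀ (x : H) (c : ℂ), x • c = Coalgebra.counit (R := ℂ) x * c)
    (hProj : Module.Projective H ℂ) :
    IsSemisimpleRing H := by
  have hsurj : Function.Surjective (LinearMap.toSpanSingleton H ℂ 1) := fun c ↦
    ⟨algebraMap ℂ H c, by simp [hTriv]⟩
  obtain ⟨s, hs⟩ := Module.projective_lifting_property _ LinearMap.id hsurj
  refine HopfAlgebra.isSemisimpleModule_of_integral (k := ℂ) (Λ := s 1) (fun x ↦ ?_) ?_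
  · have hx : x • (1 : ℂ) = algebraMap ℂ H (Coalgebra.counit x) • (1 : ℂ) := by simp [hTriv]
    rw [← smul_eq_mul, ← map_smul, hx, map_smul, smul_eq_mul, Algebra.smul_def]
  · simpa [hTriv] using LinearMap.congr_fun hs 1
end

section
/- Let p < q be prime numbers and let H be a non-semisimple Hopf algebra over ℂ of dimension p·q. Then every extension of one-dimensional H-modules splits: if V is a 2-dimensional H-module and W ⊆ V is a 1-dimensional submodule, then W has an H-module complement in V, i.e., there is a submodule W' of V with W ⊓ W' = 0 and W + W' = V. Consequently every finite-dimensional H-module all of whose composition factors are 1-dimensional is a semisimple module. -/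
open scoped TensorProduct

/-- If the sum of unit complex numbers is equal to their number, all of them are one. -/
theorem Multiset.eq_one_of_sum_eq_card {s : Multiset ℂ} (h : ∀ x ∈ s, ‖x‖ = 1)
    (hs : s.sum = s.card) : ∀ x ∈ s, x = 1 := by
  have key : ∀ t : Multiset ℂ, (∀ x ∈ t, ‖x‖ = 1) →
      t.sum.re ≤ t.card ∧ (t.sum.re = t.card → ∀ x ∈ t, x = 1) := by
    intro t
    induction t using Multiset.induction with
    | empty => simp
    | cons a t ih =>
      intro ht
      obtain ⟨h1, h2⟩ := ih fun x hx => ht x (Multiset.mem_cons_of_mem hx)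
      have ha : ‖a‖ = 1 := ht a (Multiset.mem_cons_self a t)
      have ha' : a.re ≤ 1 := ha ▸ Complex.re_le_norm a
      rw [Multiset.sum_cons, Multiset.card_cons, Complex.add_re]
      push_cast
      refine ⟨by linarith, fun he x hx => ?_⟩
      rcases Multiset.mem_cons.1 hx with rfl | hx
      · have hre : x.re = 1 := by linarith
        have : x.re ^ 2 + x.im ^ 2 = 1 := by
          have := Complex.sq_norm x
          rw [ha, Complex.normSq_apply] at this
          nlinarith
        have him : x.im = 0 := by rw [hre] at this; nlinarith
        exact Complex.ext hre him
      · exact h2 (by linarith) x hx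
  exact (key s h).2 (by rw [hs]; simp)

section Endomorphisms

variable {V : Type*} [AddCommGroup V] [Module ℂ V]

theorem Module.End.HasEigenvalue.pow_eq_one {T : Module.End ℂ V} {N : ℕ} (hT : T ^ N = 1) {μ : ℂ}
    (h : T.HasEigenvalue μ) : μ ^ N = 1 := by
  obtain ⟨v, hv⟩ := h.exists_hasEigenvector
  have := hv.pow_apply N
  rw [hT, Module.End.one_apply] at this
  have h2 : (μ ^ N - 1) • v = 0 := by rw [sub_smul, ← this]; simp
  exact sub_eq_zero.1 ((smul_eq_zero.1 h2).resolve_right hv.2)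

variable [FiniteDimensional ℂ V]

theorem Module.End.exists_eigenvector_mem (T : Module.End ℂ V) (W : Submodule ℂ V) (hW : W ≠ ⊥)
    (hT : ∀ w ∈ W, T w ∈ W) : ∃ w ∈ W, w ≠ 0 ∧ ∃ μ : ℂ, T w = μ • w := by
  have : Nontrivial W := Submodule.nontrivial_iff_ne_bot.2 hW
  obtain ⟨μ, hμ⟩ := Module.End.exists_eigenvalue (T.restrict hT)
  obtain ⟨w, hw⟩ := hμ.exists_hasEigenvector
  refine ⟨w, w.2, fun h => hw.2 (Subtype.ext h), μ, ?_⟩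
  simpa using congrArg Subtype.val hw.apply_eq_smul

theorem Module.End.eq_one_of_pow_eq_one {T : Module.End ℂ V} {N : ℕ} (hN : N ≠ 0) (hT : T ^ N = 1)
    (he : ∀ μ : ℂ, T.HasEigenvalue μ → μ = 1) : T = 1 := by
  by_contra hne
  have hR : LinearMap.range (T - 1) ≠ ⊥ := fun h => hne <| sub_eq_zero.1 <|
    LinearMap.range_eq_bot.1 h
  obtain ⟨w, ⟨u, hu⟩, hw0, μ, hμ⟩ := T.exists_eigenvector_mem _ hR (by
    rintro _ ⟨u, rfl⟩
    exact ⟨T u, by simp⟩)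
  have h1 : μ = 1 := he μ (Module.End.hasEigenvalue_of_hasEigenvector
    ⟨Module.End.mem_eigenspace_iff.2 hμ, hw0⟩)
  have hTw : T w = w := by rw [hμ, h1, one_smul]
  have hTu : T u = u + w := by rw [← hu]; simp
  have hpow : ∀ k : ℕ, (T ^ k) u = u + (k : ℂ) • w := by
    intro k
    induction k with
    | zero => simp
    | succ k ih =>
      rw [pow_succ', Module.End.mul_apply, ih, map_add, map_smul, hTw, hTu]
      push_cast
      module
  have := hpow N
  rw [hT, Module.End.one_apply, left_eq_add, smul_eq_zero] at this
  rcases this with h | h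
  · exact hN (by exact_mod_cast h)
  · exact hw0 h

theorem Module.End.eq_one_of_trace_eq_finrank {T : Module.End ℂ V} {N : ℕ} (hN : N ≠ 0)
    (hT : T ^ N = 1) (ht : LinearMap.trace ℂ V T = Module.finrank ℂ V) : T = 1 := by
  refine eq_one_of_pow_eq_one hN hT fun μ hμ => ?_
  have hs := IsAlgClosed.splits T.charpoly
  have hcard : T.charpoly.roots.card = Module.finrank ℂ V := by
    rw [← hs.natDegree_eq_card_roots, LinearMap.charpoly_natDegree]
  refine Multiset.eq_one_of_sum_eq_card (s := T.charpoly.roots) (fun x hx => ?_) ?_ μ ?_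
  · have hx' : T.HasEigenvalue x := Module.End.hasEigenvalue_iff_isRoot_charpoly _ _ |>.2
      (Polynomial.isRoot_of_mem_roots hx)
    exact Complex.norm_eq_one_of_pow_eq_one (hx'.pow_eq_one hT) hN
  · rw [← Module.End.trace_eq_sum_roots_charpoly_of_splits hs, ht, hcard]
  · exact (Polynomial.mem_roots T.charpoly_monic.ne_zero).2
      (Module.End.hasEigenvalue_iff_isRoot_charpoly _ _ |>.1 hμ)

theorem Module.End.isNilpotent_of_hasEigenvalue {T : Module.End ℂ V}
    (h : ∀ μ : ℂ, T.HasEigenvalue μ → μ = 0) : IsNilpotent T := by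
  have hs := IsAlgClosed.splits T.charpoly
  have h0 : T.charpoly.roots = Multiset.replicate T.charpoly.roots.card 0 :=
    Multiset.eq_replicate_card.2 fun x hx => h x <|
      Module.End.hasEigenvalue_iff_isRoot_charpoly _ _ |>.2 (Polynomial.isRoot_of_mem_roots hx)
  have h1 : T.charpoly = Polynomial.X ^ T.charpoly.roots.card := by
    conv_lhs => rw [hs.eq_prod_roots, T.charpoly_monic.leadingCoeff, h0]
    simp
  refine ⟨T.charpoly.roots.card, ?_⟩
  have := T.aeval_self_charpoly
  rw [h1] at this
  simpa using this

theorem Module.End.dvd_finrank_of_trace_pow_eq_zero {T : Module.End ℂ V} {N : ℕ} (hN : N ≠ 0)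
    (hT : T ^ N = 1) (ht : ∀ j, 0 < j → j < N → LinearMap.trace ℂ V (T ^ j) = 0) :
    N ∣ Module.finrank ℂ V := by
  have hN' : (N : ℂ) ≠ 0 := by exact_mod_cast hN
  set S : Module.End ℂ V := ∑ j ∈ Finset.range N, T ^ j with hS
  have hTS : T * S = S := by
    have h := mul_geom_sum T N
    rw [hT, sub_self, sub_mul, one_mul] at h
    exact sub_eq_zero.1 h
  have hpow : ∀ j, T ^ j * S = S := by
    intro j
    induction j with
    | zero => simp
    | succ j ih => rw [pow_succ, mul_assoc, hTS, ih]
  have hSS : S * S = (N : ℂ) • S := by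
    conv_lhs => enter [1]; rw [hS]
    rw [Finset.sum_mul, Finset.sum_congr rfl fun j _ => hpow j, Finset.sum_const,
      Finset.card_range, Nat.cast_smul_eq_nsmul]
  have hidem : IsIdempotentElem ((N : ℂ)⁻¹ • S) := by
    unfold IsIdempotentElem
    rw [smul_mul_smul_comm, hSS, smul_smul, mul_assoc, inv_mul_cancel₀ hN', mul_one]
  have htr := LinearMap.IsProj.trace (LinearMap.IsIdempotentElem.isProj_range _ hidem)
  have htS : LinearMap.trace ℂ V S = Module.finrank ℂ V := by
    obtain ⟨M, rfl⟩ := Nat.exists_eq_succ_of_ne_zero hN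
    rw [hS, map_sum, Finset.sum_range_succ', Finset.sum_eq_zero]
    · simp
    · intro j hj
      exact ht _ (Nat.succ_pos j) (Nat.succ_lt_succ (Finset.mem_range.1 hj))
  rw [map_smul, htS, smul_eq_mul, inv_mul_eq_iff_eq_mul₀ hN'] at htr
  exact ⟨_, by exact_mod_cast htr⟩

theorem LinearMap.finrank_eq_of_ker_eq_range_pow {X : Module.End ℂ V} {m : ℕ}
    (hX : X ^ (m + 1) = 0) (hk : LinearMap.ker X = LinearMap.range (X ^ m)) :
    Module.finrank ℂ V = (m + 1) * Module.finrank ℂ (LinearMap.range (X ^ m)) := by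
  have step : ∀ k ≤ m, Module.finrank ℂ (LinearMap.range (X ^ k)) =
      Module.finrank ℂ (LinearMap.range (X ^ (k + 1))) +
        Module.finrank ℂ (LinearMap.range (X ^ m)) := by
    intro k hkm
    have h := (X.domRestrict (LinearMap.range (X ^ k))).finrank_range_add_finrank_ker
    rw [LinearMap.range_domRestrict, LinearMap.ker_domRestrict] at h
    have h1 : (LinearMap.range (X ^ k)).map X = LinearMap.range (X ^ (k + 1)) := by
      rw [pow_succ', Module.End.mul_eq_comp, LinearMap.range_comp]
    have h2 : LinearMap.ker X ≤ LinearMap.range (X ^ k) := by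
      rw [hk]
      rintro _ ⟨v, rfl⟩
      exact ⟨(X ^ (m - k)) v, by rw [← Module.End.mul_apply, ← pow_add, Nat.add_sub_cancel' hkm]⟩
    have h3 : Module.finrank ℂ ((LinearMap.ker X).submoduleOf (LinearMap.range (X ^ k))) =
        Module.finrank ℂ (LinearMap.range (X ^ m)) := by
      rw [(Submodule.submoduleOfEquivOfLe h2).finrank_eq, hk]
    rw [← h1, ← h, ← h3]
    rfl
  have hsum : ∀ k ≤ m + 1, Module.finrank ℂ V = Module.finrank ℂ (LinearMap.range (X ^ k)) +
      k * Module.finrank ℂ (LinearMap.range (X ^ m)) := by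
    intro k
    induction k with
    | zero =>
      intro _
      rw [pow_zero, Module.End.one_eq_id, LinearMap.range_id, finrank_top, zero_mul, add_zero]
    | succ k ih =>
      intro hk'
      rw [ih (by omega), step k (by omega)]
      ring
  have := hsum (m + 1) le_rfl
  rw [hX, LinearMap.range_zero, finrank_bot, zero_add] at this
  exact this

end Endomorphisms

section QBinomial

/-- The Gaussian binomial coefficients at a complex parameter, defined by their Pascal rule. -/
def qChoose (ω : ℂ) : ℕ → ℕ → ℂ
  | _, 0 => 1
  | 0, _ + 1 => 0
  | k + 1, i + 1 => qChoose ω k i + ω ^ (i + 1) * qChoose ω k (i + 1)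

/-- The factorial at a complex parameter. -/
def qFactorial (ω : ℂ) (k : ℕ) : ℂ := ∏ j ∈ Finset.range k, ∑ i ∈ Finset.range (j + 1), ω ^ i

theorem qChoose_zero_right (ω : ℂ) (k : ℕ) : qChoose ω k 0 = 1 := by cases k <;> rfl

theorem qChoose_eq_zero_of_lt (ω : ℂ) : ∀ {k i : ℕ}, k < i → qChoose ω k i = 0
  | 0, _ + 1, _ => rfl
  | k + 1, i + 1, h => by
    rw [qChoose, qChoose_eq_zero_of_lt ω (Nat.lt_of_succ_lt_succ h),
      qChoose_eq_zero_of_lt ω (Nat.lt_of_succ_lt h)]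
    ring

theorem qChoose_self (ω : ℂ) (k : ℕ) : qChoose ω k k = 1 := by
  induction k with
  | zero => rfl
  | succ k ih => rw [qChoose, ih, qChoose_eq_zero_of_lt ω (Nat.lt_succ_self k)]; ring

theorem qFactorial_succ (ω : ℂ) (k : ℕ) :
    qFactorial ω (k + 1) = qFactorial ω k * ∑ i ∈ Finset.range (k + 1), ω ^ i :=
  Finset.prod_range_succ _ _

theorem qChoose_mul_qFactorial (ω : ℂ) (i j : ℕ) :
    qChoose ω (i + j) i * (qFactorial ω i * qFactorial ω j) = qFactorial ω (i + j) := by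
  induction i generalizing j with
  | zero => rw [qChoose_zero_right]; simp [qFactorial]
  | succ i ih =>
    induction j with
    | zero => rw [add_zero, qChoose_self]; simp [qFactorial]
    | succ j ihj =>
      have h1 := ih (j + 1)
      have hsplit : ∑ l ∈ Finset.range (i + 1 + j + 1), ω ^ l =
          ∑ l ∈ Finset.range (i + 1), ω ^ l +
            ω ^ (i + 1) * ∑ l ∈ Finset.range (j + 1), ω ^ l := by
        rw [show i + 1 + j + 1 = (i + 1) + (j + 1) by ring, Finset.sum_range_add, Finset.mul_sum]
        simp [pow_add]
      rw [show i + 1 + (j + 1) = (i + 1 + j) + 1 by ring, qChoose, qFactorial_succ ω (i + 1 + j),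
        hsplit, mul_add, ← ihj, show i + 1 + j = i + (j + 1) by ring]
      rw [show i + 1 + j = i + (j + 1) by ring] at ihj
      rw [add_mul]
      congr 1
      · rw [ihj, ← h1, qFactorial_succ ω i]
        ring
      · rw [qFactorial_succ ω j]
        ring

theorem geom_sum_ne_zero_of_isPrimitiveRoot {ω : ℂ} {r j : ℕ} (hω : IsPrimitiveRoot ω r)
    (h0 : 0 < j) (hj : j < r) : ∑ i ∈ Finset.range j, ω ^ i ≠ 0 := by
  intro h
  have := geom_sum_mul ω j
  rw [h, zero_mul] at this
  exact hω.pow_ne_one_of_pos_of_lt h0.ne' hj (sub_eq_zero.1 this.symm)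

theorem qFactorial_ne_zero {ω : ℂ} {r k : ℕ} (hω : IsPrimitiveRoot ω r) (hk : k < r) :
    qFactorial ω k ≠ 0 :=
  Finset.prod_ne_zero_iff.2 fun j hj => geom_sum_ne_zero_of_isPrimitiveRoot hω (Nat.succ_pos j)
    (by have := Finset.mem_range.1 hj; omega)

theorem qFactorial_eq_zero {ω : ℂ} {r : ℕ} (hω : IsPrimitiveRoot ω r) (hr : 1 < r) :
    qFactorial ω r = 0 :=
  Finset.prod_eq_zero (Finset.mem_range.2 (Nat.sub_lt (by omega) one_pos)) (by
    rw [Nat.sub_add_cancel hr.le]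
    exact hω.geom_sum_eq_zero hr)

theorem qChoose_eq_zero_of_isPrimitiveRoot {ω : ℂ} {r i : ℕ} (hω : IsPrimitiveRoot ω r)
    (h0 : 0 < i) (hi : i < r) : qChoose ω r i = 0 := by
  have h := qChoose_mul_qFactorial ω i (r - i)
  rw [Nat.add_sub_cancel' hi.le, qFactorial_eq_zero hω (by omega)] at h
  exact (mul_eq_zero.1 h).resolve_right
    (mul_ne_zero (qFactorial_ne_zero hω hi) (qFactorial_ne_zero hω (by omega)))

variable {A : Type*} [Ring A] [Algebra ℂ A]

theorem add_pow_of_mul_eq_smul {ω : ℂ} {a b : A} (h : b * a = ω • (a * b)) (k : ℕ) :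
    (a + b) ^ k = ∑ i ∈ Finset.range (k + 1), qChoose ω k i • (a ^ i * b ^ (k - i)) := by
  have hb : ∀ i, b * a ^ i = ω ^ i • (a ^ i * b) := by
    intro i
    induction i with
    | zero => simp
    | succ i ih =>
      rw [pow_succ, ← mul_assoc, ih, smul_mul_assoc, mul_assoc, h, mul_smul_comm, smul_smul,
        mul_assoc, pow_succ]
  induction k with
  | zero => simp [qChoose]
  | succ k ih =>
    rw [pow_succ', ih, Finset.mul_sum]
    have hterm : ∀ i ∈ Finset.range (k + 1),
        (a + b) * qChoose ω k i • (a ^ i * b ^ (k - i)) =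
          qChoose ω k i • (a ^ (i + 1) * b ^ (k + 1 - (i + 1))) +
            (ω ^ i * qChoose ω k i) • (a ^ i * b ^ (k + 1 - i)) := by
      intro i hi
      have hik : k + 1 - i = (k - i) + 1 := by have := Finset.mem_range.1 hi; omega
      rw [mul_smul_comm, add_mul, ← mul_assoc, ← mul_assoc, hb, ← pow_succ', smul_mul_assoc,
        mul_assoc (a ^ i) b, ← pow_succ', hik, smul_add, smul_smul, mul_comm (ω ^ i),
        Nat.add_sub_add_right]
    rw [Finset.sum_congr rfl hterm, Finset.sum_add_distrib, Finset.sum_range_succ' _ (k + 1)]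
    have h2 : ∑ i ∈ Finset.range (k + 1), (ω ^ i * qChoose ω k i) • (a ^ i * b ^ (k + 1 - i)) =
        ∑ i ∈ Finset.range (k + 1), (ω ^ (i + 1) * qChoose ω k (i + 1)) •
          (a ^ (i + 1) * b ^ (k + 1 - (i + 1))) + a ^ 0 * b ^ (k + 1) := by
      rw [Finset.sum_range_succ', Finset.sum_range_succ _ k,
        qChoose_eq_zero_of_lt ω (Nat.lt_succ_self k), qChoose_zero_right]
      simp
    rw [h2, ← add_assoc, ← Finset.sum_add_distrib, qChoose_zero_right, one_smul, Nat.sub_zero]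
    congr 1
    refine Finset.sum_congr rfl fun i _ => ?_
    rw [qChoose, add_smul]

theorem add_pow_of_isPrimitiveRoot {ω : ℂ} {r : ℕ} (hω : IsPrimitiveRoot ω r) (hr : r ≠ 0)
    {a b : A} (h : b * a = ω • (a * b)) : (a + b) ^ r = a ^ r + b ^ r := by
  obtain ⟨k, rfl⟩ := Nat.exists_eq_succ_of_ne_zero hr
  rw [add_pow_of_mul_eq_smul h, Finset.sum_range_succ, Finset.sum_range_succ', Finset.sum_eq_zero,
    Nat.succ_eq_add_one, qChoose_self, qChoose_zero_right]
  · simp [add_comm]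
  · intro i hi
    rw [qChoose_eq_zero_of_isPrimitiveRoot hω (Nat.succ_pos i)
      (Nat.succ_lt_succ (Finset.mem_range.1 hi)), zero_smul]

end QBinomial

section TensorSquare

variable {V : Type*} [AddCommGroup V] [Module ℂ V]

/-- The action of a skew-primitive element on a tensor square, the element and the associated
group-like element acting on the factors by `X` and `G`. -/
noncomputable def skewOp (G X : Module.End ℂ V) : Module.End ℂ (V ⊗[ℂ] V) :=
  TensorProduct.map G X + LinearMap.rTensor V X

@[simp]
theorem skewOp_tmul (G X : Module.End ℂ V) (v w : V) :
    skewOp G X (v ⊗ₜ w) = G v ⊗ₜ X w + X v ⊗ₜ w := rfl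

theorem skewOp_add_smul (G X : Module.End ℂ V) (c : ℂ) :
    skewOp G (X + c • (G - 1)) = skewOp G X + c • (TensorProduct.map G G - 1) := by
  refine TensorProduct.ext' fun v w => ?_
  simp only [skewOp_tmul, LinearMap.add_apply, LinearMap.smul_apply, LinearMap.sub_apply,
    Module.End.one_apply, TensorProduct.map_tmul, TensorProduct.tmul_add, TensorProduct.add_tmul,
    TensorProduct.tmul_smul, TensorProduct.smul_tmul', TensorProduct.tmul_sub,
    TensorProduct.sub_tmul, smul_sub]
  abel

theorem commute_skewOp_lTensor {G X : Module.End ℂ V} :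
    Commute (skewOp G X) (LinearMap.lTensor V X) := by
  refine TensorProduct.ext' fun v w => ?_
  simp

variable (β : (V ⊗[ℂ] V) ≃ₗ[ℂ] (V ⊗[ℂ] V)) {G X : Module.End ℂ V}

variable {β} in
theorem lTensor_pow_apply_of_map (hG : ∀ t, LinearMap.lTensor V G (β t) = β (TensorProduct.map G G t))
    (k : ℕ) (t : V ⊗[ℂ] V) :
    LinearMap.lTensor V (G ^ k) (β t) = β (TensorProduct.map (G ^ k) (G ^ k) t) := by
  rw [← LinearMap.lTensor_pow, ← TensorProduct.map_pow]
  induction k with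
  | zero => simp
  | succ k ih => rw [pow_succ', Module.End.mul_apply, ih, hG, pow_succ', Module.End.mul_apply]

variable {β} in
theorem lTensor_pow_apply_of_skewOp (hX : ∀ t, LinearMap.lTensor V X (β t) = β (skewOp G X t))
    (k : ℕ) (t : V ⊗[ℂ] V) :
    LinearMap.lTensor V (X ^ k) (β t) = β ((skewOp G X ^ k) t) := by
  rw [← LinearMap.lTensor_pow]
  induction k with
  | zero => simp
  | succ k ih => rw [pow_succ', Module.End.mul_apply, ih, hX, pow_succ', Module.End.mul_apply]

theorem mul_pow_of_mul_eq_smul {ω : ℂ} (h : X * G = ω • (G * X)) (k : ℕ) :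
    X * G ^ k = ω ^ k • (G ^ k * X) := by
  induction k with
  | zero => simp
  | succ k ih =>
    rw [pow_succ, ← mul_assoc, ih, smul_mul_assoc, mul_assoc, h, mul_smul_comm, smul_smul,
      mul_assoc, pow_succ]

theorem pow_mul_of_mul_eq_smul {ω : ℂ} (h : X * G = ω • (G * X)) (k : ℕ) :
    X ^ k * G = ω ^ k • (G * X ^ k) := by
  induction k with
  | zero => simp
  | succ k ih =>
    rw [pow_succ', mul_assoc, ih, mul_smul_comm, ← mul_assoc, h, smul_mul_assoc, smul_smul,
      mul_assoc, pow_succ]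

theorem skewOp_pow_of_isPrimitiveRoot {ω : ℂ} {r : ℕ} (hω : IsPrimitiveRoot ω r) (hr : r ≠ 0)
    (hGr : G ^ r = 1) (h : X * G = ω • (G * X)) : skewOp G X ^ r = skewOp 1 (X ^ r) := by
  unfold skewOp
  rw [add_pow_of_isPrimitiveRoot hω hr, TensorProduct.map_pow, LinearMap.rTensor_pow, hGr]
  refine TensorProduct.ext' fun v w => ?_
  have := LinearMap.congr_fun h v
  simp only [Module.End.mul_apply, LinearMap.smul_apply] at this
  simp [this, TensorProduct.smul_tmul']

theorem tmul_ne_zero_of_field {v w : V} (hv : v ≠ 0) (hw : w ≠ 0) : v ⊗ₜ[ℂ] w ≠ 0 := by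
  obtain ⟨f, hf⟩ := not_forall.1 (mt (Module.forall_dual_apply_eq_zero_iff ℂ v).1 hv)
  intro h
  have := congrArg (fun t => TensorProduct.lid ℂ V (LinearMap.rTensor V f t)) h
  simp [hf, hw] at this

/-- A nonzero tensor is detected by a functional on its first factor. -/
theorem exists_contract_ne_zero {t : V ⊗[ℂ] V} (ht : t ≠ 0) :
    ∃ φ : V ⊗[ℂ] V →ₗ[ℂ] V, φ t ≠ 0 ∧
      ∀ (T : Module.End ℂ V) (s : V ⊗[ℂ] V), φ (LinearMap.lTensor V T s) = T (φ s) := by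
  by_contra! hcon
  let b := Module.Free.chooseBasis ℂ V
  refine ht ((TensorProduct.equivFinsuppOfBasisLeft b).injective ?_)
  rw [map_zero]
  ext i
  let φ : V ⊗[ℂ] V →ₗ[ℂ] V :=
    (TensorProduct.lid ℂ V).toLinearMap ∘ₗ LinearMap.rTensor V (b.coord i)
  have hφ : ∀ (T : Module.End ℂ V) (s : V ⊗[ℂ] V), φ (LinearMap.lTensor V T s) = T (φ s) := by
    intro T s
    have : φ ∘ₗ LinearMap.lTensor V T = T ∘ₗ φ := by
      refine TensorProduct.ext' fun v w => ?_
      simp [φ]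
    exact LinearMap.congr_fun this s
  have h0 : φ t = 0 := by
    by_contra h
    obtain ⟨T, s, hs⟩ := hcon φ h
    exact hs (hφ T s)
  have heq : ∀ s : V ⊗[ℂ] V, TensorProduct.equivFinsuppOfBasisLeft b s i = φ s := by
    intro s
    induction s with
    | zero => simp
    | add x y hx hy => simp [hx, hy]
    | tmul x y => simp [φ]
  rw [heq, h0]
  rfl

variable {β}

/-- Joint eigenvalues of `G` and `X` are closed under composition as affine maps. -/
theorem exists_joint_eigenvector_mul
    (hG : ∀ t, LinearMap.lTensor V G (β t) = β (TensorProduct.map G G t))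
    (hX : ∀ t, LinearMap.lTensor V X (β t) = β (skewOp G X t))
    {v w : V} {a b c d : ℂ} (hv : v ≠ 0) (hw : w ≠ 0) (hGv : G v = a • v) (hXv : X v = b • v)
    (hGw : G w = c • w) (hXw : X w = d • w) :
    ∃ u : V, u ≠ 0 ∧ G u = (a * c) • u ∧ X u = (a * d + b) • u := by
  have ht : β (v ⊗ₜ[ℂ] w) ≠ 0 := by
    rw [Ne, LinearEquiv.map_eq_zero_iff]
    exact tmul_ne_zero_of_field hv hw
  obtain ⟨φ, hφ, hφT⟩ := exists_contract_ne_zero ht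
  refine ⟨_, hφ, ?_, ?_⟩
  · rw [← hφT, hG, TensorProduct.map_tmul, hGv, hGw, TensorProduct.smul_tmul_smul, map_smul,
      map_smul]
  · rw [← hφT, hX, skewOp_tmul, hGv, hXw, hXv, TensorProduct.smul_tmul_smul,
      ← TensorProduct.smul_tmul', ← add_smul, map_smul, map_smul]

variable [FiniteDimensional ℂ V]

theorem trace_eq_zero_or_finrank
    (hG : ∀ t, LinearMap.lTensor V G (β t) = β (TensorProduct.map G G t)) :
    LinearMap.trace ℂ V G = 0 ∨ LinearMap.trace ℂ V G = Module.finrank ℂ V := by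
  have h1 : LinearMap.lTensor V G = β.conj (TensorProduct.map G G) := by
    refine LinearMap.ext fun t => ?_
    obtain ⟨s, rfl⟩ := β.surjective t
    rw [hG, LinearEquiv.conj_apply_apply, LinearEquiv.symm_apply_apply]
  have h2 := congrArg (LinearMap.trace ℂ (V ⊗[ℂ] V)) h1
  rw [LinearMap.trace_conj', LinearMap.trace_tensorProduct', LinearMap.lTensor,
    LinearMap.trace_tensorProduct', LinearMap.trace_id] at h2
  by_cases h : LinearMap.trace ℂ V G = 0
  · exact Or.inl h
  · exact Or.inr (mul_right_cancel₀ h h2).symm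

theorem trace_eq_zero_of_ne_one {N : ℕ} (hN : N ≠ 0) (hGN : G ^ N = 1) (h1 : G ≠ 1)
    (hG : ∀ t, LinearMap.lTensor V G (β t) = β (TensorProduct.map G G t)) :
    LinearMap.trace ℂ V G = 0 :=
  (trace_eq_zero_or_finrank hG).resolve_right fun h =>
    h1 (Module.End.eq_one_of_trace_eq_finrank hN hGN h)

theorem isNilpotent_of_skewOp_one
    (hX : ∀ t, LinearMap.lTensor V X (β t) = β (skewOp 1 X t)) : IsNilpotent X := by
  refine Module.End.isNilpotent_of_hasEigenvalue fun μ hμ => ?_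
  by_contra hμ0
  have h1 : ∀ t : V ⊗[ℂ] V, LinearMap.lTensor V (1 : Module.End ℂ V) (β t) =
      β (TensorProduct.map (1 : Module.End ℂ V) (1 : Module.End ℂ V) t) := fun t => by
    rw [TensorProduct.map_one, Module.End.one_eq_id, LinearMap.lTensor_id]
    rfl
  have hk : ∀ k : ℕ, X.HasEigenvalue (((k : ℂ) + 1) * μ) := by
    obtain ⟨v, hv⟩ := hμ.exists_hasEigenvector
    intro k
    induction k with
    | zero => simpa using hμ
    | succ k ih =>
      obtain ⟨w, hw⟩ := ih.exists_hasEigenvector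
      obtain ⟨u, hu, -, hXu⟩ := exists_joint_eigenvector_mul (a := 1) (c := 1) h1 hX hv.2 hw.2
        (by simp) hv.apply_eq_smul (by simp) hw.apply_eq_smul
      refine Module.End.hasEigenvalue_of_hasEigenvector (x := u)
        ⟨Module.End.mem_eigenspace_iff.2 ?_, hu⟩
      rw [hXu]
      congr 1
      push_cast
      ring
  refine Set.infinite_of_injective_forall_mem (s := {μ | X.HasEigenvalue μ})
    (f := fun k : ℕ => ((k : ℂ) + 1) * μ) (fun i j hij => ?_) hk X.finite_hasEigenvalue
  have := add_right_cancel (mul_right_cancel₀ hμ0 hij)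
  exact_mod_cast this

theorem isNilpotent_of_isPrimitiveRoot {ω : ℂ} {r : ℕ} (hω : IsPrimitiveRoot ω r) (hr : r ≠ 0)
    (hGr : G ^ r = 1) (h : X * G = ω • (G * X))
    (hX : ∀ t, LinearMap.lTensor V X (β t) = β (skewOp G X t)) : IsNilpotent X := by
  have := isNilpotent_of_skewOp_one (β := β) (X := X ^ r) fun t => by
    rw [lTensor_pow_apply_of_skewOp hX, skewOp_pow_of_isPrimitiveRoot hω hr hGr h]
  exact (IsNilpotent.pow_iff_pos hr).1 this

/-- A skew-primitive operator commuting with its group-like operator is nilpotent up to a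
trivial skew-primitive operator. -/
theorem exists_isNilpotent_add_smul (hinj : Function.Injective G) (hc : X * G = G * X)
    (hG : ∀ t, LinearMap.lTensor V G (β t) = β (TensorProduct.map G G t))
    (hX : ∀ t, LinearMap.lTensor V X (β t) = β (skewOp G X t)) :
    ∃ c : ℂ, IsNilpotent (X + c • (G - 1)) := by
  let S : Set (ℂ × ℂ) := {s | ∃ v : V, v ≠ 0 ∧ G v = s.1 • v ∧ X v = s.2 • v}
  have hS : S.Finite := by
    refine (G.finite_hasEigenvalue.prod X.finite_hasEigenvalue).subset ?_
    rintro s ⟨v, hv, hGv, hXv⟩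
    exact ⟨Module.End.hasEigenvalue_of_hasEigenvector ⟨Module.End.mem_eigenspace_iff.2 hGv, hv⟩,
      Module.End.hasEigenvalue_of_hasEigenvector ⟨Module.End.mem_eigenspace_iff.2 hXv, hv⟩⟩
  have hmul : ∀ s ∈ S, ∀ s' ∈ S, (s.1 * s'.1, s.1 * s'.2 + s.2) ∈ S := by
    rintro s ⟨v, hv, hGv, hXv⟩ s' ⟨w, hw, hGw, hXw⟩
    exact exists_joint_eigenvector_mul hG hX hv hw hGv hXv hGw hXw
  have hne : ∀ s ∈ S, s.1 ≠ 0 := by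
    rintro s ⟨v, hv, hGv, -⟩ h
    rw [h, zero_smul, ← map_zero G] at hGv
    exact hv (hinj hGv)
  set F := hS.toFinset with hF
  have hfix : ∀ s ∈ S, s.1 * ∑ x ∈ F, x.2 + (F.card : ℂ) * s.2 = ∑ x ∈ F, x.2 := by
    intro s hs
    have hinj' : Set.InjOn (fun x : ℂ × ℂ => (s.1 * x.1, s.1 * x.2 + s.2)) F := by
      rintro ⟨a, b⟩ - ⟨a', b'⟩ - hab
      simp only [Prod.mk.injEq, add_left_inj, mul_right_inj' (hne s hs)] at hab
      exact Prod.ext hab.1 hab.2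
    have himg : F.image (fun x : ℂ × ℂ => (s.1 * x.1, s.1 * x.2 + s.2)) = F := by
      refine Finset.eq_of_subset_of_card_le (fun y hy => ?_) ?_
      · obtain ⟨x, hx, rfl⟩ := Finset.mem_image.1 hy
        exact hS.mem_toFinset.2 (hmul s hs x (hS.mem_toFinset.1 hx))
      · rw [Finset.card_image_of_injOn hinj']
    conv_rhs => rw [← himg]
    rw [Finset.sum_image hinj', Finset.sum_add_distrib, Finset.mul_sum, Finset.sum_const,
      nsmul_eq_mul]
  refine ⟨(∑ x ∈ F, x.2) / F.card, Module.End.isNilpotent_of_hasEigenvalue fun μ hμ => ?_⟩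
  set c := (∑ x ∈ F, x.2) / F.card
  set Y := X + c • (G - 1) with hY
  have hYG : Y * G = G * Y := by
    rw [hY, add_mul, mul_add, hc, smul_mul_assoc, mul_smul_comm, sub_mul, mul_sub, one_mul, mul_one]
  obtain ⟨v, hvμ, hv, a, hGv⟩ := G.exists_eigenvector_mem (Y.eigenspace μ) hμ (fun w hw => by
    rw [Module.End.mem_eigenspace_iff] at hw ⊢
    rw [← Module.End.mul_apply, hYG, Module.End.mul_apply, hw, map_smul])
  rw [Module.End.mem_eigenspace_iff] at hvμ
  have hXv : X v = (μ - c * (a - 1)) • v := by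
    have : X v = Y v - c • (G v - v) := by simp [hY]
    rw [this, hvμ, hGv]
    module
  have hs : (a, μ - c * (a - 1)) ∈ S := ⟨v, hv, hGv, hXv⟩
  have hcard : (F.card : ℂ) ≠ 0 := by
    have : F.Nonempty := ⟨_, hS.mem_toFinset.2 hs⟩
    exact_mod_cast this.card_pos.ne'
  have h := hfix _ hs
  have hcF : ∑ x ∈ F, x.2 = c * F.card := (div_mul_cancel₀ _ hcard).symm
  rw [hcF] at h
  have : (F.card : ℂ) * μ = 0 := by linear_combination h
  exact (mul_eq_zero.1 this).resolve_left hcard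

end TensorSquare

section NilpotentSkewPrimitive

variable {V : Type*} [AddCommGroup V] [Module ℂ V] {G X : Module.End ℂ V} {ω : ℂ} {m : ℕ}

theorem skewOp_pow_tmul_of_apply_apply_eq_zero (h : X * G = ω • (G * X)) {u : V}
    (hu : X (X u) = 0) (v : V) (k : ℕ) :
    (skewOp G X ^ (k + 1)) (u ⊗ₜ v) = (G ^ (k + 1)) u ⊗ₜ (X ^ (k + 1)) v +
      (∑ i ∈ Finset.range (k + 1), ω ^ i) • ((G ^ k) (X u) ⊗ₜ (X ^ k) v) := by
  have hcomm : ∀ (k : ℕ) (w : V), X ((G ^ k) w) = ω ^ k • (G ^ k) (X w) := fun k w => by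
    simpa using LinearMap.congr_fun (mul_pow_of_mul_eq_smul h k) w
  induction k with
  | zero => simp
  | succ k ih =>
    rw [pow_succ', Module.End.mul_apply, ih, map_add, map_smul, skewOp_tmul, skewOp_tmul,
      hcomm k (X u), hu, hcomm (k + 1) u, map_zero, smul_zero, TensorProduct.zero_tmul, add_zero,
      ← Module.End.mul_apply, ← pow_succ', ← Module.End.mul_apply G, ← pow_succ',
      ← Module.End.mul_apply X, ← pow_succ', ← Module.End.mul_apply X, ← pow_succ',
      Finset.sum_range_succ _ (k + 1), ← TensorProduct.smul_tmul']
    module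

theorem skewOp_pow_tmul_of_apply_eq_zero (h : X * G = ω • (G * X)) {w : V} (hw : X w = 0) (v : V)
    (k : ℕ) : (skewOp G X ^ k) (w ⊗ₜ v) = (G ^ k) w ⊗ₜ (X ^ k) v := by
  cases k with
  | zero => simp
  | succ k =>
    rw [skewOp_pow_tmul_of_apply_apply_eq_zero h (by rw [hw, map_zero]), hw, map_zero,
      TensorProduct.zero_tmul, smul_zero, add_zero]

theorem skewOp_pow_apply_of_lTensor_eq_zero {t : V ⊗[ℂ] V} (ht : LinearMap.lTensor V X t = 0)
    (k : ℕ) : (skewOp G X ^ k) t = LinearMap.rTensor V (X ^ k) t := by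
  have hcomm : ∀ s : V ⊗[ℂ] V, TensorProduct.map G X s =
      LinearMap.rTensor V G (LinearMap.lTensor V X s) := fun s => by
    rw [← LinearMap.comp_apply, LinearMap.rTensor_comp_lTensor]
  have hl : ∀ k : ℕ, LinearMap.lTensor V X (LinearMap.rTensor V (X ^ k) t) = 0 := fun k => by
    rw [← LinearMap.comp_apply, LinearMap.lTensor_comp_rTensor, ← LinearMap.rTensor_comp_lTensor,
      LinearMap.comp_apply, ht, map_zero]
  induction k with
  | zero => simp [Module.End.one_eq_id]
  | succ k ih =>
    rw [pow_succ', Module.End.mul_apply, ih, skewOp, LinearMap.add_apply, hcomm, hl, map_zero,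
      zero_add, pow_succ' X, LinearMap.rTensor_mul, Module.End.mul_apply]

variable {β : (V ⊗[ℂ] V) ≃ₗ[ℂ] (V ⊗[ℂ] V)}

/-- A complement of the kernel of the top power of a nilpotent skew-primitive operator, tensored
with the whole space, is identified with the tensor product with the range of that power. -/
noncomputable def skewTopMap (β : (V ⊗[ℂ] V) ≃ₗ[ℂ] (V ⊗[ℂ] V)) (Y : Module.End ℂ V)
    (U : Submodule ℂ V) : U ⊗[ℂ] V →ₗ[ℂ] V ⊗[ℂ] LinearMap.range Y :=
  LinearMap.lTensor V Y.rangeRestrict ∘ₗ β.toLinearMap ∘ₗ LinearMap.rTensor V U.subtype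

theorem lTensor_subtype_skewTopMap (Y : Module.End ℂ V) (U : Submodule ℂ V) (t : U ⊗[ℂ] V) :
    LinearMap.lTensor V (LinearMap.range Y).subtype (skewTopMap β Y U t) =
      LinearMap.lTensor V Y (β (LinearMap.rTensor V U.subtype t)) := by
  rw [skewTopMap, LinearMap.comp_apply, LinearMap.comp_apply, ← LinearMap.comp_apply,
    ← LinearMap.lTensor_comp, LinearMap.subtype_comp_codRestrict]
  rfl

theorem geom_sum_eq_zero_of_skewOp (hG : Function.Injective G) (h : X * G = ω • (G * X))
    (hX : ∀ t, LinearMap.lTensor V X (β t) = β (skewOp G X t)) (hm0 : m ≠ 0) (hm : X ^ m ≠ 0)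
    (hm1 : X ^ (m + 1) = 0) : ∑ i ∈ Finset.range (m + 1), ω ^ i = 0 := by
  obtain ⟨v, hv⟩ : ∃ v, (X ^ m) v ≠ 0 := by
    by_contra! hcon
    exact hm (LinearMap.ext hcon)
  obtain ⟨l, rfl⟩ := Nat.exists_eq_succ_of_ne_zero hm0
  have hu1 : X ((X ^ l) v) ≠ 0 := by rwa [← Module.End.mul_apply, ← pow_succ']
  have hu2 : X (X ((X ^ l) v)) = 0 := by
    rw [← Module.End.mul_apply X (X ^ l), ← pow_succ', ← Module.End.mul_apply, ← pow_succ', hm1,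
      LinearMap.zero_apply]
  have hD := lTensor_pow_apply_of_skewOp hX (l + 1 + 1) ((X ^ l) v ⊗ₜ v)
  rw [hm1, LinearMap.lTensor_zero, LinearMap.zero_apply, eq_comm, LinearEquiv.map_eq_zero_iff,
    skewOp_pow_tmul_of_apply_apply_eq_zero h hu2, hm1, LinearMap.zero_apply,
    TensorProduct.tmul_zero, zero_add, smul_eq_zero] at hD
  refine hD.resolve_right (tmul_ne_zero_of_field (fun h0 => hu1 ?_) hv)
  have hGinj : Function.Injective (G ^ (l + 1)) := by
    rw [Module.End.coe_pow]
    exact hG.iterate _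
  exact hGinj (h0.trans (map_zero _).symm)

theorem eq_zero_of_skewOp_pow_eq_zero {U : Submodule ℂ V}
    (hU : Disjoint U (LinearMap.ker (X ^ m))) (hm1 : X ^ (m + 1) = 0) {t : U ⊗[ℂ] V}
    (ht : (skewOp G X ^ m) (LinearMap.rTensor V U.subtype t) = 0) : t = 0 := by
  set L := LinearMap.lTensor U X with hL
  have hLs : ∀ s, LinearMap.rTensor V U.subtype (L s) =
      LinearMap.lTensor V X (LinearMap.rTensor V U.subtype s) := fun s => by
    rw [← LinearMap.comp_apply, ← LinearMap.comp_apply, hL, LinearMap.rTensor_comp_lTensor,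
      LinearMap.lTensor_comp_rTensor]
  have hinj : Function.Injective (LinearMap.rTensor V ((X ^ m) ∘ₗ U.subtype)) := by
    refine Module.Flat.rTensor_preserves_injective_linearMap _ ?_
    rw [← LinearMap.ker_eq_bot, LinearMap.ker_comp]
    rwa [← Submodule.disjoint_iff_comap_eq_bot]
  have hker : ∀ s, L s = 0 → (skewOp G X ^ m) (LinearMap.rTensor V U.subtype s) = 0 → s = 0 := by
    intro s hs h0
    rw [skewOp_pow_apply_of_lTensor_eq_zero (by rw [← hLs, hs, map_zero]),
      ← LinearMap.comp_apply, ← LinearMap.rTensor_comp] at h0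
    exact hinj (h0.trans (map_zero _).symm)
  have hcomm : ∀ k : ℕ, (skewOp G X ^ m) (LinearMap.rTensor V U.subtype ((L ^ k) t)) = 0 := by
    intro k
    induction k with
    | zero => simpa using ht
    | succ k ih =>
      rw [pow_succ', Module.End.mul_apply, hLs, ← Module.End.mul_apply,
        (commute_skewOp_lTensor.pow_left m).eq, Module.End.mul_apply, ih, map_zero]
  have hdesc : ∀ k : ℕ, (L ^ k) t = 0 → t = 0 := by
    intro k
    induction k with
    | zero => simp
    | succ k ih =>
      intro hk
      exact ih (hker _ (by rwa [← Module.End.mul_apply, ← pow_succ']) (hcomm k))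
  refine hdesc (m + 1) ?_
  rw [hL, LinearMap.lTensor_pow, hm1, LinearMap.lTensor_zero, LinearMap.zero_apply]

variable [FiniteDimensional ℂ V]

theorem bijective_skewTopMap {U : Submodule ℂ V}
    (hX : ∀ t, LinearMap.lTensor V X (β t) = β (skewOp G X t))
    (hU : IsCompl U (LinearMap.ker (X ^ m))) (hm1 : X ^ (m + 1) = 0) :
    Function.Bijective (skewTopMap β (X ^ m) U) := by
  have hinj : Function.Injective (skewTopMap β (X ^ m) U) := by
    refine (injective_iff_map_eq_zero _).2 fun t ht => ?_
    have h := lTensor_subtype_skewTopMap (β := β) (X ^ m) U t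
    rw [ht, map_zero, lTensor_pow_apply_of_skewOp hX, eq_comm, LinearEquiv.map_eq_zero_iff] at h
    exact eq_zero_of_skewOp_pow_eq_zero hU.disjoint hm1 h
  refine ⟨hinj, (LinearMap.injective_iff_surjective_of_finrank_eq_finrank ?_).1 hinj⟩
  have h1 := Submodule.finrank_add_eq_of_isCompl hU
  have h2 := (X ^ m).finrank_range_add_finrank_ker
  rw [Module.finrank_tensorProduct, Module.finrank_tensorProduct, mul_comm]
  congr 1
  omega

theorem ker_eq_range_pow_of_skewOp {N : ℕ} (hN : N ≠ 0) (hGN : G ^ N = 1)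
    (h : X * G = ω • (G * X)) (hX : ∀ t, LinearMap.lTensor V X (β t) = β (skewOp G X t))
    (hm : X ^ m ≠ 0) (hm1 : X ^ (m + 1) = 0) : LinearMap.ker X = LinearMap.range (X ^ m) := by
  refine le_antisymm (fun w hw => ?_) ?_
  swap
  · rintro _ ⟨v, rfl⟩
    rw [LinearMap.mem_ker, ← Module.End.mul_apply, ← pow_succ', hm1, LinearMap.zero_apply]
  rw [LinearMap.mem_ker] at hw
  obtain ⟨v, hv⟩ : ∃ v, (X ^ m) v ≠ 0 := by
    by_contra! hcon
    exact hm (LinearMap.ext hcon)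
  obtain ⟨U, hU⟩ := (LinearMap.ker (X ^ m)).exists_isCompl
  obtain ⟨k, hk⟩ : ∃ k, m + k = N * m := ⟨N * m - m, Nat.add_sub_cancel'
    (Nat.le_mul_of_pos_left m (Nat.pos_of_ne_zero hN))⟩
  set w' := (G ^ k) w with hw'
  have hXw' : X w' = 0 := by
    have := LinearMap.congr_fun (mul_pow_of_mul_eq_smul h k) w
    simpa [hw] using this
  have hGw' : (G ^ m) w' = w := by
    rw [hw', ← Module.End.mul_apply, ← pow_add, hk, pow_mul, hGN, one_pow, Module.End.one_apply]
  obtain ⟨t, ht⟩ := (bijective_skewTopMap hX hU.symm hm1).2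
    (LinearMap.lTensor V (X ^ m).rangeRestrict (β (w' ⊗ₜ v)))
  have heq : (skewOp G X ^ m) (LinearMap.rTensor V U.subtype t) = w ⊗ₜ (X ^ m) v := by
    have h1 := lTensor_subtype_skewTopMap (β := β) (X ^ m) U t
    rw [ht, ← LinearMap.comp_apply, ← LinearMap.lTensor_comp,
      LinearMap.subtype_comp_codRestrict, lTensor_pow_apply_of_skewOp hX,
      lTensor_pow_apply_of_skewOp hX, skewOp_pow_tmul_of_apply_eq_zero h hXw', hGw'] at h1
    exact (β.injective h1).symm
  have hLs : LinearMap.rTensor V U.subtype (LinearMap.lTensor U X t) =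
      LinearMap.lTensor V X (LinearMap.rTensor V U.subtype t) := by
    rw [← LinearMap.comp_apply, ← LinearMap.comp_apply, LinearMap.rTensor_comp_lTensor,
      LinearMap.lTensor_comp_rTensor]
  have hLt : LinearMap.lTensor U X t = 0 := by
    refine eq_zero_of_skewOp_pow_eq_zero (G := G) hU.symm.disjoint hm1 ?_
    rw [hLs, ← Module.End.mul_apply, (commute_skewOp_lTensor.pow_left m).eq,
      Module.End.mul_apply, heq, LinearMap.lTensor_tmul, ← Module.End.mul_apply, ← pow_succ', hm1,
      LinearMap.zero_apply, TensorProduct.tmul_zero]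
  rw [skewOp_pow_apply_of_lTensor_eq_zero (by rw [← hLs, hLt, map_zero])] at heq
  obtain ⟨f, hf⟩ := not_forall.1 (mt (Module.forall_dual_apply_eq_zero_iff ℂ _).1 hv)
  let φ : V ⊗[ℂ] V →ₗ[ℂ] V := (TensorProduct.rid ℂ V).toLinearMap ∘ₗ LinearMap.lTensor V f
  have hφ : φ ∘ₗ LinearMap.rTensor V (X ^ m) = (X ^ m) ∘ₗ φ := by
    refine TensorProduct.ext' fun a b => ?_
    simp [φ]
  have hφw : (X ^ m) (φ (LinearMap.rTensor V U.subtype t)) = f ((X ^ m) v) • w := by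
    rw [← LinearMap.comp_apply, ← hφ, LinearMap.comp_apply, heq]
    simp [φ]
  have : w = (f ((X ^ m) v))⁻¹ • (f ((X ^ m) v) • w) := by
    rw [smul_smul, inv_mul_cancel₀ hf, one_smul]
  rw [this, ← hφw]
  exact Submodule.smul_mem _ _ ⟨_, rfl⟩

theorem trace_restrict_range_pow_eq_zero {U : Submodule ℂ V} [Nontrivial V] (hω : ω ≠ 0)
    (h : X * G = ω • (G * X))
    (hG : ∀ t, LinearMap.lTensor V G (β t) = β (TensorProduct.map G G t))
    {K : Module.End ℂ V}
    (hX : ∀ t, LinearMap.lTensor V X (β t) = β (skewOp K X t))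
    (hU : IsCompl U (LinearMap.ker (X ^ m))) (hm1 : X ^ (m + 1) = 0) (hGU : ∀ u ∈ U, G u ∈ U)
    (hGI : ∀ u ∈ LinearMap.range (X ^ m), G u ∈ LinearMap.range (X ^ m))
    (htr : LinearMap.trace ℂ V G = 0) :
    LinearMap.trace ℂ (LinearMap.range (X ^ m)) (G.restrict hGI) = 0 := by
  let Φ := LinearEquiv.ofBijective _ (bijective_skewTopMap hX hU hm1)
  have hΦ : Φ.conj (TensorProduct.map (G.restrict hGU) G) =
      ω ^ m • LinearMap.lTensor V (G.restrict hGI) := by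
    refine LinearMap.ext fun s => ?_
    obtain ⟨t, rfl⟩ := Φ.surjective s
    rw [LinearEquiv.conj_apply_apply, LinearEquiv.symm_apply_apply]
    refine Module.Flat.lTensor_preserves_injective_linearMap (M := V)
      (LinearMap.range (X ^ m)).subtype (Submodule.injective_subtype _) ?_
    have h1 : ∀ t, LinearMap.lTensor V (LinearMap.range (X ^ m)).subtype (Φ t) =
        LinearMap.lTensor V (X ^ m) (β (LinearMap.rTensor V U.subtype t)) :=
      lTensor_subtype_skewTopMap _ _
    have h2 : LinearMap.rTensor V U.subtype (TensorProduct.map (G.restrict hGU) G t) =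
        TensorProduct.map G G (LinearMap.rTensor V U.subtype t) := by
      rw [← LinearMap.comp_apply, ← LinearMap.comp_apply]
      refine LinearMap.congr_fun (TensorProduct.ext' fun a b => ?_) t
      simp
    have h3 : LinearMap.lTensor V (LinearMap.range (X ^ m)).subtype ∘ₗ
        LinearMap.lTensor V (G.restrict hGI) =
        LinearMap.lTensor V G ∘ₗ LinearMap.lTensor V (LinearMap.range (X ^ m)).subtype := by
      refine TensorProduct.ext' fun a b => ?_
      simp
    rw [LinearMap.smul_apply, map_smul, ← LinearMap.comp_apply (f := LinearMap.lTensor V _), h3,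
      LinearMap.comp_apply, h1, h1, h2, ← hG, ← LinearMap.comp_apply, ← LinearMap.comp_apply,
      ← LinearMap.lTensor_comp, ← LinearMap.lTensor_comp, ← Module.End.mul_eq_comp,
      ← Module.End.mul_eq_comp, pow_mul_of_mul_eq_smul h, LinearMap.lTensor_smul,
      LinearMap.smul_apply]
  have h4 := congrArg (LinearMap.trace ℂ _) hΦ
  rw [LinearMap.trace_conj', LinearMap.trace_tensorProduct', htr, mul_zero, map_smul,
    LinearMap.lTensor, LinearMap.trace_tensorProduct', LinearMap.trace_id] at h4
  simpa [hω, Module.finrank_pos.ne'] using h4.symm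

theorem dvd_finrank_range_pow {N : ℕ} [Nontrivial V] (hN : N ≠ 0) (hGN : G ^ N = 1)
    (hG1 : ∀ j, 0 < j → j < N → G ^ j ≠ 1) (hω : ω ≠ 0) (h : X * G = ω • (G * X))
    (hG : ∀ t, LinearMap.lTensor V G (β t) = β (TensorProduct.map G G t))
    (hX : ∀ t, LinearMap.lTensor V X (β t) = β (skewOp G X t)) (hm1 : X ^ (m + 1) = 0) :
    N ∣ Module.finrank ℂ (LinearMap.range (X ^ m)) := by
  have hss : G.IsSemisimple := by
    refine Module.End.isSemisimple_of_squarefree_aeval_eq_zero (p := Polynomial.X ^ N - 1) ?_ ?_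
    · exact (Polynomial.separable_X_pow_sub_C (1 : ℂ) (by exact_mod_cast hN)
        one_ne_zero).squarefree
    · simp [hGN]
  have hXG : ∀ v, (X ^ m) (G v) = ω ^ m • G ((X ^ m) v) := fun v => by
    simpa using LinearMap.congr_fun (pow_mul_of_mul_eq_smul h m) v
  obtain ⟨U, hGU, hU⟩ := Module.End.isSemisimple_iff.1 hss (LinearMap.ker (X ^ m)) (by
    intro v hv
    rw [Submodule.mem_comap, LinearMap.mem_ker, hXG, LinearMap.mem_ker.1 hv, map_zero, smul_zero])
  have hGI : ∀ u ∈ LinearMap.range (X ^ m), G u ∈ LinearMap.range (X ^ m) := by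
    rintro _ ⟨v, rfl⟩
    refine ⟨(ω ^ m)⁻¹ • G v, ?_⟩
    rw [map_smul, hXG, smul_smul, inv_mul_cancel₀ (pow_ne_zero m hω), one_smul]
  refine Module.End.dvd_finrank_of_trace_pow_eq_zero (T := G.restrict hGI) hN ?_ fun j h0 hj => ?_
  · rw [Module.End.pow_restrict N hGI]
    refine LinearMap.ext fun v => Subtype.ext ?_
    simp [hGN]
  · rw [Module.End.pow_restrict j hGI]
    have hpG : ∀ t, LinearMap.lTensor V (G ^ j) (β t) = β (TensorProduct.map (G ^ j) (G ^ j) t) :=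
      lTensor_pow_apply_of_map hG j
    refine trace_restrict_range_pow_eq_zero (ω := ω ^ j) (U := U) (pow_ne_zero j hω)
      (mul_pow_of_mul_eq_smul h j) hpG hX hU.symm hm1 ?_ _
      (trace_eq_zero_of_ne_one hN ?_ (hG1 j h0 hj) hpG)
    · intro u hu
      rw [Module.End.coe_pow]
      exact Set.MapsTo.iterate (s := (U : Set V)) hGU j hu
    · rw [← pow_mul, mul_comm, pow_mul, hGN, one_pow]

end NilpotentSkewPrimitive

section ColinearMaps

variable {C : Type*} [AddCommGroup C] [Module ℂ C] [Coalgebra ℂ C]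

variable (C) in
/-- The algebra of endomorphisms of a coalgebra commuting with the left coaction given by
comultiplication. -/
def colinearEnd : Subalgebra ℂ (Module.End ℂ C) where
  carrier := {T | ∀ x : C, Coalgebra.comul (R := ℂ) (T x) = LinearMap.lTensor C T (Coalgebra.comul x)}
  mul_mem' {S T} hS hT x := by
    rw [Module.End.mul_apply, hS, hT, LinearMap.lTensor_mul, Module.End.mul_apply]
  add_mem' {S T} hS hT x := by
    rw [LinearMap.add_apply, map_add, hS, hT, LinearMap.lTensor_add, LinearMap.add_apply]
  algebraMap_mem' c x := by
    rw [Algebra.algebraMap_eq_smul_one, LinearMap.lTensor_smul, Module.End.one_eq_id,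
      LinearMap.lTensor_id]
    simp

/-- The action `x ↦ ∑ φ(x₂) x₁` of a functional on a coalgebra. -/
noncomputable def dualAct (φ : C →ₗ[ℂ] ℂ) : Module.End ℂ C :=
  (TensorProduct.rid ℂ C).toLinearMap ∘ₗ LinearMap.lTensor C φ ∘ₗ Coalgebra.comul

theorem dualAct_apply (φ : C →ₗ[ℂ] ℂ) (x : C) :
    dualAct φ x = TensorProduct.rid ℂ C (LinearMap.lTensor C φ (Coalgebra.comul x)) := rfl

theorem dualAct_mem_colinearEnd (φ : C →ₗ[ℂ] ℂ) : dualAct φ ∈ colinearEnd C := by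
  intro x
  have h1 : (Coalgebra.comul (R := ℂ) (A := C)) ∘ₗ (TensorProduct.rid ℂ C).toLinearMap ∘ₗ
      LinearMap.lTensor C φ = (TensorProduct.rid ℂ (C ⊗[ℂ] C)).toLinearMap ∘ₗ
        LinearMap.lTensor (C ⊗[ℂ] C) φ ∘ₗ LinearMap.rTensor C Coalgebra.comul := by
    refine TensorProduct.ext' fun a b => ?_
    simp
  have h2 : ∀ (a : C) (s : C ⊗[ℂ] C), TensorProduct.rid ℂ (C ⊗[ℂ] C)
      (LinearMap.lTensor (C ⊗[ℂ] C) φ ((TensorProduct.assoc ℂ C C C).symm (a ⊗ₜ s))) =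
        a ⊗ₜ TensorProduct.rid ℂ C (LinearMap.lTensor C φ s) := by
    intro a s
    induction s with
    | zero => simp
    | add s t hs ht => simp only [TensorProduct.tmul_add, map_add, hs, ht]
    | tmul b c => simp
  have h3 : (TensorProduct.rid ℂ (C ⊗[ℂ] C)).toLinearMap ∘ₗ LinearMap.lTensor (C ⊗[ℂ] C) φ ∘ₗ
      (TensorProduct.assoc ℂ C C C).symm.toLinearMap ∘ₗ LinearMap.lTensor C Coalgebra.comul =
        LinearMap.lTensor C (dualAct φ) := by
    refine TensorProduct.ext' fun a b => ?_
    exact h2 a (Coalgebra.comul b)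
  rw [← h3]
  have h4 := LinearMap.congr_fun h1 (Coalgebra.comul x)
  simp only [LinearMap.comp_apply, LinearEquiv.coe_coe] at h4 ⊢
  rw [dualAct_apply, h4, ← Coalgebra.coassoc_apply, LinearEquiv.symm_apply_apply]

theorem counit_dualAct (φ : C →ₗ[ℂ] ℂ) (x : C) : Coalgebra.counit (R := ℂ) (dualAct φ x) = φ x := by
  have h : (Coalgebra.counit (R := ℂ) (A := C)) ∘ₗ (TensorProduct.rid ℂ C).toLinearMap ∘ₗ
      LinearMap.lTensor C φ = φ ∘ₗ (TensorProduct.lid ℂ C).toLinearMap ∘ₗ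
        LinearMap.rTensor C Coalgebra.counit := by
    refine TensorProduct.ext' fun a b => ?_
    simp [mul_comm]
  have := LinearMap.congr_fun h (Coalgebra.comul x)
  simpa [dualAct_apply] using this

theorem dualAct_counit_comp {T : Module.End ℂ C} (hT : T ∈ colinearEnd C) :
    dualAct (Coalgebra.counit ∘ₗ T) = T := by
  refine LinearMap.ext fun x => ?_
  rw [dualAct_apply, LinearMap.lTensor_comp, LinearMap.comp_apply, ← hT x,
    Coalgebra.lTensor_counit_comul]
  simp

theorem colinearEnd_ext {S T : Module.End ℂ C} (hS : S ∈ colinearEnd C) (hT : T ∈ colinearEnd C)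
    (h : Coalgebra.counit (R := ℂ) ∘ₗ S = Coalgebra.counit ∘ₗ T) : S = T := by
  rw [← dualAct_counit_comp hS, h, dualAct_counit_comp hT]

end ColinearMaps

section GaloisMap

variable {H : Type*} [Ring H] [HopfAlgebra ℂ H]

variable (H) in
/-- The Galois map `x ⊗ y ↦ ∑ x₁ ⊗ x₂ y` of a Hopf algebra. -/
noncomputable def galoisMap : H ⊗[ℂ] H →ₗ[ℂ] H ⊗[ℂ] H :=
  TensorProduct.lift
    ((LinearMap.lTensorHom H ∘ₗ (LinearMap.mul ℂ H).flip).flip ∘ₗ Coalgebra.comul)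

theorem galoisMap_tmul (x y : H) : galoisMap H (x ⊗ₜ y) =
    LinearMap.lTensor H (LinearMap.mulRight ℂ y) (Coalgebra.comul x) := rfl

theorem galoisMap_injective : Function.Injective (galoisMap H) := by
  let S : H →ₗ[ℂ] H := HopfAlgebra.antipode ℂ
  let γ : H ⊗[ℂ] H →ₗ[ℂ] H ⊗[ℂ] H := LinearMap.lTensor H (LinearMap.mul' ℂ H) ∘ₗ
    (TensorProduct.assoc ℂ H H H).toLinearMap ∘ₗ
      LinearMap.rTensor H (LinearMap.lTensor H S ∘ₗ Coalgebra.comul)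
  have key : ∀ (y b : H) (s : H ⊗[ℂ] H),
      LinearMap.lTensor H (LinearMap.mul' ℂ H) (TensorProduct.assoc ℂ H H H
        (LinearMap.lTensor H S s ⊗ₜ (b * y))) =
      LinearMap.lTensor H (LinearMap.mulRight ℂ y) (LinearMap.lTensor H
        (LinearMap.mul' ℂ H ∘ₗ LinearMap.rTensor H S)
          (TensorProduct.assoc ℂ H H H (s ⊗ₜ b))) := by
    intro y b s
    induction s with
    | zero => simp
    | add s t hs ht => simp only [TensorProduct.add_tmul, map_add, hs, ht]
    | tmul a c => simp [mul_assoc]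
  have h : γ ∘ₗ galoisMap H = LinearMap.id := by
    refine TensorProduct.ext' fun x y => ?_
    have h1 : γ ∘ₗ LinearMap.lTensor H (LinearMap.mulRight ℂ y) =
        LinearMap.lTensor H (LinearMap.mulRight ℂ y) ∘ₗ LinearMap.lTensor H
          (LinearMap.mul' ℂ H ∘ₗ LinearMap.rTensor H S) ∘ₗ
            (TensorProduct.assoc ℂ H H H).toLinearMap ∘ₗ LinearMap.rTensor H Coalgebra.comul :=
      TensorProduct.ext' fun a b => key y b (Coalgebra.comul a)
    have h2 := LinearMap.congr_fun h1 (Coalgebra.comul x)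
    simp only [LinearMap.comp_apply, LinearEquiv.coe_coe] at h2
    rw [LinearMap.comp_apply, galoisMap_tmul, h2, Coalgebra.coassoc_apply,
      ← LinearMap.comp_apply (f := LinearMap.lTensor H (LinearMap.mul' ℂ H ∘ₗ _)),
      ← LinearMap.lTensor_comp, LinearMap.comp_assoc, HopfAlgebra.mul_antipode_rTensor_comul,
      LinearMap.lTensor_comp, LinearMap.comp_apply, Coalgebra.lTensor_counit_comul]
    simp
  exact Function.LeftInverse.injective (g := γ) fun t => LinearMap.congr_fun h t

variable (H) in
/-- The Galois map of a finite-dimensional Hopf algebra as a linear equivalence. -/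
noncomputable def galoisEquiv [FiniteDimensional ℂ H] : H ⊗[ℂ] H ≃ₗ[ℂ] H ⊗[ℂ] H :=
  LinearEquiv.ofInjectiveEndo (galoisMap H) galoisMap_injective

variable {G X : Module.End ℂ H} [FiniteDimensional ℂ H]

theorem lTensor_galoisEquiv_of_map_mul (hG : G ∈ colinearEnd H)
    (hm : ∀ x y, G (x * y) = G x * G y) (t : H ⊗[ℂ] H) :
    LinearMap.lTensor H G (galoisEquiv H t) = galoisEquiv H (TensorProduct.map G G t) := by
  have h : LinearMap.lTensor H G ∘ₗ galoisMap H = galoisMap H ∘ₗ TensorProduct.map G G := by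
    refine TensorProduct.ext' fun x y => ?_
    have h1 : G ∘ₗ LinearMap.mulRight ℂ y = LinearMap.mulRight ℂ (G y) ∘ₗ G :=
      LinearMap.ext fun z => hm z y
    rw [LinearMap.comp_apply, LinearMap.comp_apply, galoisMap_tmul, TensorProduct.map_tmul,
      galoisMap_tmul, hG x, ← LinearMap.comp_apply, ← LinearMap.lTensor_comp, h1,
      LinearMap.lTensor_comp, LinearMap.comp_apply]
  exact LinearMap.congr_fun h t

theorem lTensor_galoisEquiv_of_skew (hG : G ∈ colinearEnd H) (hX : X ∈ colinearEnd H)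
    (hm : ∀ x y, X (x * y) = G x * X y + X x * y) (t : H ⊗[ℂ] H) :
    LinearMap.lTensor H X (galoisEquiv H t) = galoisEquiv H (skewOp G X t) := by
  have h : LinearMap.lTensor H X ∘ₗ galoisMap H = galoisMap H ∘ₗ skewOp G X := by
    refine TensorProduct.ext' fun x y => ?_
    have h1 : X ∘ₗ LinearMap.mulRight ℂ y =
        LinearMap.mulRight ℂ (X y) ∘ₗ G + LinearMap.mulRight ℂ y ∘ₗ X :=
      LinearMap.ext fun z => hm z y
    rw [LinearMap.comp_apply, LinearMap.comp_apply, galoisMap_tmul, skewOp_tmul, map_add,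
      galoisMap_tmul, galoisMap_tmul, hG x, hX x, ← LinearMap.comp_apply, ← LinearMap.lTensor_comp,
      h1, LinearMap.lTensor_add, LinearMap.lTensor_comp, LinearMap.lTensor_comp]
    rfl
  exact LinearMap.congr_fun h t

end GaloisMap

section SkewPrimitive

variable {H : Type*} [Ring H] [HopfAlgebra ℂ H]

theorem dualAct_mul {χ ψ f : H →ₗ[ℂ] ℂ} (hf : ∀ x y, f (x * y) = χ x * f y + f x * ψ y) (x y : H) :
    dualAct f (x * y) = dualAct χ x * dualAct f y + dualAct f x * dualAct ψ y := by
  have key : ∀ s t : H ⊗[ℂ] H, TensorProduct.rid ℂ H (LinearMap.lTensor H f (s * t)) =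
      TensorProduct.rid ℂ H (LinearMap.lTensor H χ s) *
          TensorProduct.rid ℂ H (LinearMap.lTensor H f t) +
        TensorProduct.rid ℂ H (LinearMap.lTensor H f s) *
          TensorProduct.rid ℂ H (LinearMap.lTensor H ψ t) := by
    intro s t
    induction s with
    | zero => simp
    | add s s' hs hs' => simp only [add_mul, map_add, hs, hs']; abel
    | tmul a b =>
      induction t with
      | zero => simp
      | add t t' ht ht' => simp only [mul_add, map_add, ht, ht']; abel
      | tmul c d =>
        simp only [Algebra.TensorProduct.tmul_mul_tmul, LinearMap.lTensor_tmul,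
          TensorProduct.rid_tmul, hf, smul_mul_smul_comm, add_smul]
  rw [dualAct_apply, Bialgebra.comul_mul, key]
  rfl

theorem dualAct_algHom_mul (χ : H →ₐ[ℂ] ℂ) (x y : H) :
    dualAct χ.toLinearMap (x * y) = dualAct χ.toLinearMap x * dualAct χ.toLinearMap y := by
  have key : ∀ s t : H ⊗[ℂ] H, TensorProduct.rid ℂ H (LinearMap.lTensor H χ.toLinearMap (s * t)) =
      TensorProduct.rid ℂ H (LinearMap.lTensor H χ.toLinearMap s) *
          TensorProduct.rid ℂ H (LinearMap.lTensor H χ.toLinearMap t) := by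
    intro s t
    induction s with
    | zero => simp
    | add s s' hs hs' => simp only [add_mul, map_add, hs, hs']
    | tmul a b =>
      induction t with
      | zero => simp
      | add t t' ht ht' => simp only [mul_add, map_add, ht, ht']
      | tmul c d =>
        simp only [Algebra.TensorProduct.tmul_mul_tmul, LinearMap.lTensor_tmul,
          TensorProduct.rid_tmul, AlgHom.toLinearMap_apply, map_mul, smul_mul_smul_comm]
  rw [dualAct_apply, Bialgebra.comul_mul, key]
  rfl

/-- The action of a character as an algebra endomorphism. -/
noncomputable def charAct (χ : H →ₐ[ℂ] ℂ) : H →ₐ[ℂ] H :=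
  AlgHom.ofLinearMap (dualAct χ.toLinearMap) (by simp [dualAct_apply, Algebra.TensorProduct.one_def])
    (dualAct_algHom_mul χ)

theorem charAct_injective (χ : H →ₐ[ℂ] ℂ) : Function.Injective (charAct χ) := by
  let S : H →ₗ[ℂ] H := HopfAlgebra.antipode ℂ
  have h : dualAct (χ.toLinearMap ∘ₗ S) * dualAct χ.toLinearMap = 1 := by
    refine colinearEnd_ext (mul_mem (dualAct_mem_colinearEnd _) (dualAct_mem_colinearEnd _))
      (one_mem _) ?_
    refine LinearMap.ext fun x => ?_
    rw [LinearMap.comp_apply, Module.End.mul_apply, counit_dualAct]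
    have h1 : (χ.toLinearMap ∘ₗ S) ∘ₗ (TensorProduct.rid ℂ H).toLinearMap ∘ₗ
        LinearMap.lTensor H χ.toLinearMap =
          χ.toLinearMap ∘ₗ LinearMap.mul' ℂ H ∘ₗ LinearMap.rTensor H S := by
      refine TensorProduct.ext' fun a b => ?_
      simp [mul_comm]
    have h2 := LinearMap.congr_fun h1 (Coalgebra.comul x)
    simp only [LinearMap.comp_apply, LinearEquiv.coe_coe, ← dualAct_apply, S,
      HopfAlgebra.mul_antipode_rTensor_comul_apply] at h2
    simpa using h2
  exact Function.LeftInverse.injective (g := dualAct (χ.toLinearMap ∘ₗ S))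
    fun x => LinearMap.congr_fun h x

variable [FiniteDimensional ℂ H]

theorem isOfFinOrder_of_mem_colinearEnd {G : H →ₐ[ℂ] H} (hG : AlgHom.toEnd G ∈ colinearEnd H)
    (hinj : Function.Injective G) : IsOfFinOrder (AlgHom.toEnd (R := ℂ) G) := by
  have hni : ¬ Function.Injective fun k : ℕ => (Bialgebra.counitAlgHom ℂ H).comp (G ^ k) := by
    intro h
    have := ((linearIndependent_algHom_toLinearMap ℂ H ℂ).comp _ h).finite
    exact not_finite ℕ
  rw [Function.not_injective_iff] at hni
  obtain ⟨a, b, hab, hne⟩ := hni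
  wlog hlt : a < b generalizing a b
  · exact this b a hab.symm hne.symm (lt_of_le_of_ne (not_lt.1 hlt) hne.symm)
  have h : AlgHom.toEnd (R := ℂ) G ^ a = AlgHom.toEnd (R := ℂ) G ^ b := by
    refine colinearEnd_ext (pow_mem hG a) (pow_mem hG b) ?_
    rw [← map_pow, ← map_pow]
    exact congrArg AlgHom.toLinearMap hab
  refine isOfFinOrder_iff_pow_eq_one.2 ⟨b - a, Nat.sub_pos_of_lt hlt, LinearMap.ext fun x => ?_⟩
  have hinja : Function.Injective (AlgHom.toEnd (R := ℂ) G ^ a) := by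
    rw [Module.End.coe_pow]
    exact Function.Injective.iterate (f := AlgHom.toEnd (R := ℂ) G) hinj a
  refine hinja ?_
  rw [← Module.End.mul_apply, ← pow_add, Nat.add_sub_cancel' hlt.le, ← h]
  rfl

/-- If `N = dim H`, the powers of a group-like operator of order `N` span the colinear operators. -/
theorem commute_of_mem_colinearEnd_of_orderOf_eq {G : H →ₐ[ℂ] H}
    (hG : AlgHom.toEnd G ∈ colinearEnd H)
    (ho : orderOf (AlgHom.toEnd (R := ℂ) G) = Module.finrank ℂ H) {X : Module.End ℂ H}
    (hX : X ∈ colinearEnd H) : Commute X (AlgHom.toEnd G) := by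
  set T := AlgHom.toEnd (R := ℂ) G with hT
  have hinj : Function.Injective fun k : Fin (Module.finrank ℂ H) =>
      (Bialgebra.counitAlgHom ℂ H).comp (G ^ (k : ℕ)) := by
    intro a b hab
    have h : T ^ (a : ℕ) = T ^ (b : ℕ) := by
      refine colinearEnd_ext (pow_mem hG _) (pow_mem hG _) ?_
      rw [hT, ← map_pow, ← map_pow]
      exact congrArg AlgHom.toLinearMap hab
    exact Fin.ext (pow_injOn_Iio_orderOf (x := T) (a.2.trans_eq ho.symm)
      (b.2.trans_eq ho.symm) h)
  have hspan := ((linearIndependent_algHom_toLinearMap ℂ H ℂ).comp _ hinj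
    ).span_eq_top_of_card_eq_finrank' (by simp [Subspace.dual_finrank_eq])
  have hmem : Coalgebra.counit ∘ₗ X ∈ Submodule.span ℂ (Set.range
      (AlgHom.toLinearMap ∘ fun k : Fin (Module.finrank ℂ H) =>
        (Bialgebra.counitAlgHom ℂ H).comp (G ^ (k : ℕ)))) := hspan ▸ Submodule.mem_top
  obtain ⟨c, hc⟩ := (Submodule.mem_span_range_iff_exists_fun ℂ).1 hmem
  have hXc : X = ∑ k, c k • T ^ (k : ℕ) := by
    refine colinearEnd_ext hX (sum_mem fun k _ => Subalgebra.smul_mem _ (pow_mem hG _) _) ?_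
    rw [← hc]
    refine LinearMap.ext fun x => ?_
    simp [hT, Module.End.coe_pow]
  rw [hXc]
  exact Commute.sum_left _ _ _ fun k _ => ((Commute.refl T).pow_left _).smul_left _

end SkewPrimitive

section CharacterExtensions

variable {H : Type*} [Ring H] [HopfAlgebra ℂ H] [FiniteDimensional ℂ H] {p q : ℕ}

theorem IsNilpotent.exists_pow_ne_zero {R : Type*} [MonoidWithZero R] [Nontrivial R] {x : R}
    (h : IsNilpotent x) : ∃ m, x ^ m ≠ 0 ∧ x ^ (m + 1) = 0 := by
  classical
  obtain ⟨m, hm⟩ : ∃ m, Nat.find h = m + 1 := Nat.exists_eq_succ_of_ne_zero fun h0 => by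
    have := Nat.find_spec h
    rw [h0, pow_zero] at this
    exact one_ne_zero this
  exact ⟨m, Nat.find_min h (by omega), hm ▸ Nat.find_spec h⟩

theorem eq_one_of_skew_of_mul_eq_smul (hp : p.Prime) (hq : q.Prime) (hpq : p ≠ q)
    (hdim : Module.finrank ℂ H = p * q) {G : H →ₐ[ℂ] H} (hG : AlgHom.toEnd G ∈ colinearEnd H)
    (hinj : Function.Injective G) {X : Module.End ℂ H} (hX : X ∈ colinearEnd H)
    (hm : ∀ x y, X (x * y) = G x * X y + X x * y) (hX0 : X ≠ 0) {ω : ℂ}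
    (h : X * AlgHom.toEnd G = ω • (AlgHom.toEnd G * X)) : ω = 1 := by
  have hfin := isOfFinOrder_of_mem_colinearEnd hG hinj
  have hGβ := lTensor_galoisEquiv_of_map_mul hG (map_mul G)
  have hXβ := lTensor_galoisEquiv_of_skew hG hX hm
  set T := AlgHom.toEnd (R := ℂ) G with hT
  have hN : orderOf T ≠ 0 := hfin.orderOf_pos.ne'
  have hTN := pow_orderOf_eq_one T
  have hT1 : ∀ j, 0 < j → j < orderOf T → T ^ j ≠ 1 := fun j h0 hj =>
    pow_ne_one_of_lt_orderOf h0.ne' hj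
  have hcancel : ∀ c : ℂ, ∀ k, X * T ^ k = c • (T ^ k * X) → T ^ k = 1 → c = 1 := by
    intro c k hk hk1
    rw [hk1, mul_one, one_mul, ← sub_eq_zero, ← one_smul ℂ X, smul_smul, ← sub_smul,
      smul_eq_zero] at hk
    have := hk.resolve_right hX0
    linear_combination -this
  have hωN : ω ^ orderOf T = 1 := hcancel _ _ (mul_pow_of_mul_eq_smul h _) hTN
  have hω0 : ω ≠ 0 := fun h0 => by simp [h0, hN] at hωN
  have hV : Nontrivial H := Module.nontrivial_of_finrank_pos (R := ℂ)
    (hdim ▸ Nat.mul_pos hp.pos hq.pos)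
  by_contra hω
  have hN1 : orderOf T ≠ 1 := fun h1 => hω (by simpa [h1] using hωN)
  have hNpq : orderOf T ≠ p * q := fun hNn => by
    have hc : X * T = T * X :=
      (commute_of_mem_colinearEnd_of_orderOf_eq hG (hNn.trans hdim.symm) hX).eq
    have h0 : (ω - 1) • (T * X) = 0 := (sub_smul ω 1 (T * X)).trans <| by
      rw [← h, one_smul, hc, sub_self]
    rcases smul_eq_zero.1 h0 with h0 | h0
    · exact hω (sub_eq_zero.1 h0)
    · exact hX0 (LinearMap.ext fun v => hinj ((LinearMap.congr_fun h0 v).trans (map_zero G).symm))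
  have hdvd : orderOf T ∣ p * q := hdim ▸ Module.End.dvd_finrank_of_trace_pow_eq_zero hN hTN
    fun j h0 hj => trace_eq_zero_of_ne_one hN (by rw [← pow_mul, mul_comm, pow_mul, hTN, one_pow])
      (hT1 j h0 hj) (lTensor_pow_apply_of_map hGβ j)
  have hprime : orderOf T = p ∨ orderOf T = q := by
    obtain ⟨a, b, ha, hb, hab⟩ := (Nat.dvd_mul).1 hdvd
    rcases (Nat.dvd_prime hp).1 ha with rfl | rfl <;> rcases (Nat.dvd_prime hq).1 hb with rfl | rfl
    · exact absurd hab.symm hN1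
    · exact Or.inr (by rw [← hab, one_mul])
    · exact Or.inl (by rw [← hab, mul_one])
    · exact absurd hab.symm hNpq
  have hNprime : (orderOf T).Prime := by rcases hprime with h | h <;> rwa [h]
  have hprim : IsPrimitiveRoot ω (orderOf T) := by
    have := Fact.mk hNprime
    rw [← orderOf_eq_prime hωN hω]
    exact IsPrimitiveRoot.orderOf ω
  obtain ⟨m, hXm, hXm1⟩ :=
    (isNilpotent_of_isPrimitiveRoot hprim hN hTN h hXβ).exists_pow_ne_zero
  have hm0 : m ≠ 0 := by
    rintro rfl
    exact hX0 (by simpa using hXm1)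
  have hgeom := geom_sum_eq_zero_of_skewOp hinj h hXβ hm0 hXm hXm1
  have h1 : orderOf T ∣ m + 1 := hprim.dvd_of_pow_eq_one _ <| by
    have := mul_geom_sum ω (m + 1)
    rw [hgeom, mul_zero] at this
    exact (sub_eq_zero.1 this.symm)
  have h2 := dvd_finrank_range_pow hN hTN hT1 hω0 h hGβ hXβ hXm1
  have h3 := LinearMap.finrank_eq_of_ker_eq_range_pow hXm1
    (ker_eq_range_pow_of_skewOp hN hTN h hXβ hXm hXm1)
  have h4 : orderOf T * orderOf T ∣ p * q := hdim ▸ h3 ▸ mul_dvd_mul h1 h2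
  rcases hprime with h | h <;> rw [h] at h4
  · exact hpq ((Nat.prime_dvd_prime_iff_eq hp hq).1 (Nat.dvd_of_mul_dvd_mul_left hp.pos h4))
  · exact hpq ((Nat.prime_dvd_prime_iff_eq hq hp).1
      (Nat.dvd_of_mul_dvd_mul_right hq.pos h4)).symm

theorem exists_eq_smul_sub_one_of_commute {G : H →ₐ[ℂ] H} (hG : AlgHom.toEnd G ∈ colinearEnd H)
    (hinj : Function.Injective G) {X : Module.End ℂ H} (hX : X ∈ colinearEnd H)
    (hm : ∀ x y, X (x * y) = G x * X y + X x * y) (hc : X * AlgHom.toEnd G = AlgHom.toEnd G * X) :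
    ∃ c : ℂ, X = c • (AlgHom.toEnd G - 1) := by
  have hGβ := lTensor_galoisEquiv_of_map_mul hG (map_mul G)
  have hXβ := lTensor_galoisEquiv_of_skew hG hX hm
  obtain ⟨c, hnil⟩ := exists_isNilpotent_add_smul hinj hc hGβ hXβ
  set T := AlgHom.toEnd (R := ℂ) G with hT
  set Y := X + c • (T - 1) with hY
  have hYβ : ∀ t, LinearMap.lTensor H Y (galoisEquiv H t) = galoisEquiv H (skewOp T Y t) := by
    intro t
    have h1 := hGβ t
    have h2 := hXβ t
    rw [hY, skewOp_add_smul, LinearMap.lTensor_add, LinearMap.lTensor_smul, LinearMap.lTensor_sub]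
    simp only [LinearMap.add_apply, LinearMap.smul_apply, LinearMap.sub_apply, map_add, map_smul,
      map_sub, Module.End.one_eq_id, LinearMap.lTensor_id, LinearMap.id_apply, h1, h2]
  have hYT : Y * T = (1 : ℂ) • (T * Y) := by
    rw [one_smul, hY, add_mul, mul_add, hc, smul_mul_assoc, mul_smul_comm, sub_mul, mul_sub,
      one_mul, mul_one]
  suffices h0 : Y = 0 from
    ⟨-c, (eq_neg_of_add_eq_zero_left h0).trans (neg_smul c (T - 1)).symm⟩
  by_contra hY0
  have := nontrivial_of_ne Y 0 hY0
  obtain ⟨m, hYm, hYm1⟩ := hnil.exists_pow_ne_zero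
  have hm0 : m ≠ 0 := by
    rintro rfl
    exact hY0 (by simpa using hYm1)
  have := geom_sum_eq_zero_of_skewOp hinj hYT hYβ hm0 hYm hYm1
  simp at this
  norm_cast at this

theorem exists_eq_smul_sub_one (hp : p.Prime) (hq : q.Prime) (hpq : p ≠ q)
    (hdim : Module.finrank ℂ H = p * q) {G : H →ₐ[ℂ] H} (hG : AlgHom.toEnd G ∈ colinearEnd H)
    (hinj : Function.Injective G) {X : Module.End ℂ H} (hX : X ∈ colinearEnd H)
    (hm : ∀ x y, X (x * y) = G x * X y + X x * y) : ∃ c : ℂ, X = c • (AlgHom.toEnd G - 1) := by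
  refine exists_eq_smul_sub_one_of_commute hG hinj hX hm ?_
  have hfin := isOfFinOrder_of_mem_colinearEnd hG hinj
  have hN : orderOf (AlgHom.toEnd (R := ℂ) G) ≠ 0 := hfin.orderOf_pos.ne'
  have hTN := pow_orderOf_eq_one (AlgHom.toEnd (R := ℂ) G)
  set T := AlgHom.toEnd (R := ℂ) G with hT
  obtain ⟨N, hNs⟩ := Nat.exists_eq_succ_of_ne_zero hN
  rw [hNs] at hTN
  let P : Submodule ℂ (Module.End ℂ H) :=
    { carrier := {Y | Y ∈ colinearEnd H ∧ ∀ x y, Y (x * y) = G x * Y y + Y x * y}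
      add_mem' := fun {Y Z} hY hZ => ⟨add_mem hY.1 hZ.1, fun x y => by
        simp only [LinearMap.add_apply, hY.2, hZ.2, mul_add, add_mul]
        abel⟩
      zero_mem' := ⟨zero_mem _, by simp⟩
      smul_mem' := fun c Y hY => ⟨Subalgebra.smul_mem _ hY.1 c, fun x y => by
        simp only [LinearMap.smul_apply, hY.2, smul_add, mul_smul_comm, smul_mul_assoc]⟩ }
  let Ad : Module.End ℂ (Module.End ℂ H) :=
    LinearMap.mulLeft ℂ T * LinearMap.mulRight ℂ (T ^ N)
  have hAd : ∀ Y, Ad Y = T * (Y * T ^ N) := fun Y => rfl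
  have hinv1 : T * T ^ N = 1 := by rw [← pow_succ', hTN]
  have hinv2 : T ^ N * T = 1 := by rw [← pow_succ, hTN]
  have hGinv : ∀ x, G ((T ^ N) x) = x := fun x => LinearMap.congr_fun hinv1 x
  have hAdP : ∀ Y ∈ P, Ad Y ∈ P := by
    rintro Y ⟨hY, hYm⟩
    refine ⟨mul_mem hG (mul_mem hY (pow_mem hG N)), fun x y => ?_⟩
    have hmulN : (T ^ N) (x * y) = (T ^ N) x * (T ^ N) y := by
      rw [hT, ← map_pow]
      exact map_mul (G ^ N) x y
    have happ : ∀ z, Ad Y z = G (Y ((T ^ N) z)) := fun z => rfl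
    rw [happ, happ, happ, hmulN, hYm, hGinv, map_add, map_mul, map_mul, hGinv]
  have hAdpow : ∀ k Y, (Ad ^ k) Y = T ^ k * (Y * (T ^ N) ^ k) := by
    intro k Y
    induction k with
    | zero => simp
    | succ k ih => rw [pow_succ', Module.End.mul_apply, ih, hAd, pow_succ', pow_succ, mul_assoc,
        mul_assoc, mul_assoc]
  have hAd1 : Ad.restrict hAdP ^ N.succ = 1 := by
    rw [Module.End.pow_restrict N.succ hAdP]
    refine LinearMap.ext fun Y => Subtype.ext ?_
    rw [LinearMap.coe_restrict_apply, hAdpow, hTN, ← pow_mul, mul_comm N, pow_mul, hTN]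
    simp
  have hone : Ad.restrict hAdP = 1 := by
    refine Module.End.eq_one_of_pow_eq_one (V := P) (T := Ad.restrict hAdP) N.succ_ne_zero hAd1 fun μ hμ => ?_
    obtain ⟨⟨Y, hY⟩, hYe⟩ := hμ.exists_hasEigenvector
    have hYμ : Ad Y = μ • Y := congrArg Subtype.val hYe.apply_eq_smul
    have hY0 : Y ≠ 0 := fun h => hYe.2 (Subtype.ext h)
    have hμ0 : μ ≠ 0 := fun h => by
      have := hμ.pow_eq_one hAd1
      simp [h] at this
    have h1 : Y * T = μ⁻¹ • (T * Y) := by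
      have h2 : T * Y = μ • (Y * T) := by
        rw [← smul_mul_assoc, ← hYμ, hAd, mul_assoc, mul_assoc, hinv2, mul_one]
      rw [h2, smul_smul, inv_mul_cancel₀ hμ0, one_smul]
    have := eq_one_of_skew_of_mul_eq_smul hp hq hpq hdim hG hinj hY.1 hY.2 hY0 h1
    exact inv_eq_one.1 this
  have hXP : Ad X = X := congrArg Subtype.val (LinearMap.congr_fun hone ⟨X, hX, hm⟩)
  conv_lhs => rw [← hXP, hAd, mul_assoc, mul_assoc, hinv2, mul_one]

/-- Extensions of characters of a Hopf algebra of dimension `p * q` split, in cocycle form. -/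
theorem exists_eq_smul_sub_of_mul (hp : p.Prime) (hq : q.Prime) (hpq : p ≠ q)
    (hdim : Module.finrank ℂ H = p * q) (χ ψ : H →ₐ[ℂ] ℂ) (f : H →ₗ[ℂ] ℂ)
    (hf : ∀ x y, f (x * y) = χ x * f y + f x * ψ y) : ∃ c : ℂ, ∀ x, f x = c * (χ x - ψ x) := by
  have hχ : AlgHom.toEnd (charAct χ) ∈ colinearEnd H := dualAct_mem_colinearEnd _
  have hψ : AlgHom.toEnd (charAct ψ) ∈ colinearEnd H := dualAct_mem_colinearEnd _
  have hψinj := charAct_injective ψ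
  have hfin := isOfFinOrder_of_mem_colinearEnd hψ hψinj
  have hpow := pow_orderOf_eq_one (AlgHom.toEnd (R := ℂ) (charAct ψ))
  obtain ⟨N, hN⟩ := Nat.exists_eq_succ_of_ne_zero hfin.orderOf_pos.ne'
  rw [hN] at hpow
  set Ψ := AlgHom.toEnd (R := ℂ) (charAct ψ) with hΨ
  have hinv1 : ∀ x, charAct ψ ((charAct ψ ^ N) x) = x := fun x => by
    rw [pow_succ', hΨ, ← map_pow] at hpow
    exact LinearMap.congr_fun hpow x
  have hinv2 : Ψ ^ N * Ψ = 1 := by rw [← pow_succ, hpow]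
  obtain ⟨c, hc⟩ := exists_eq_smul_sub_one hp hq hpq hdim (G := charAct χ * charAct ψ ^ N)
    (X := dualAct f * Ψ ^ N) (by
      rw [map_mul, map_pow]
      exact mul_mem hχ (pow_mem hψ N))
    ((charAct_injective χ).comp (Function.LeftInverse.injective hinv1))
    (mul_mem (dualAct_mem_colinearEnd f) (pow_mem hψ N)) fun x y => by
      have happ : ∀ z, (dualAct f * Ψ ^ N) z = dualAct f ((charAct ψ ^ N) z) := fun z => by
        rw [hΨ, ← map_pow]
        rfl
      have := dualAct_mul (χ := χ.toLinearMap) (ψ := ψ.toLinearMap) hf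
        ((charAct ψ ^ N) x) ((charAct ψ ^ N) y)
      rw [happ, happ, happ, map_mul, this]
      exact congrArg (_ + _ * ·) (hinv1 y)
  have hF : dualAct f = c • (dualAct χ.toLinearMap - dualAct ψ.toLinearMap) := by
    have h1 := congrArg (· * Ψ) hc
    simp only [map_mul, map_pow, ← hΨ, smul_mul_assoc, sub_mul, mul_assoc, hinv2, mul_one,
      one_mul] at h1
    exact h1
  refine ⟨c, fun x => ?_⟩
  have := congrArg (Coalgebra.counit (R := ℂ)) (LinearMap.congr_fun hF x)
  simpa [counit_dualAct] using this

end CharacterExtensions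

section Modules

variable {H : Type*} [Ring H] [HopfAlgebra ℂ H] {V : Type*} [AddCommGroup V] [Module ℂ V]
  [Module H V] [IsScalarTower ℂ H V]

theorem exists_character_of_forall_smul_eq {e : V} (he : e ≠ 0)
    (h : ∀ x : H, ∃ c : ℂ, x • e = c • e) : ∃ ψ : H →ₐ[ℂ] ℂ, ∀ x : H, x • e = ψ x • e := by
  have := IsScalarTower.to_smulCommClass' (R := ℂ) (A := H) (M := V)
  choose ψ hψ using h
  have huniq : ∀ {a b : ℂ}, a • e = b • e → a = b := fun hab => smul_left_injective ℂ he hab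
  let l : H →ₗ[ℂ] ℂ :=
    { toFun := ψ
      map_add' := fun x y => huniq (by rw [← hψ, add_smul, add_smul, hψ, hψ])
      map_smul' := fun c x => huniq (by
        rw [← hψ, smul_assoc, hψ, smul_smul, RingHom.id_apply, smul_eq_mul]) }
  refine ⟨AlgHom.ofLinearMap l (huniq ?_) fun x y => huniq ?_, hψ⟩
  · change ψ 1 • e = _
    rw [← hψ, one_smul, one_smul]
  · change ψ (x * y) • e = (ψ x * ψ y) • e
    rw [← hψ, mul_smul, hψ y, smul_comm, hψ x, smul_smul, mul_comm]

variable (H V) in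
/-- The vectors spanning at most one-dimensional submodules. -/
def eigenvectors : Set V := {v | ∃ χ : H →ₐ[ℂ] ℂ, ∀ x : H, x • v = χ x • v}

theorem mem_span_of_mem_span_eigenvectors {v : V} (hv : v ∈ Submodule.span H (eigenvectors H V)) :
    v ∈ Submodule.span ℂ (eigenvectors H V) := by
  have := IsScalarTower.to_smulCommClass' (R := ℂ) (A := H) (M := V)
  induction hv using Submodule.span_induction with
  | mem v hv => exact Submodule.subset_span hv
  | zero => exact zero_mem _
  | add v w _ _ hv hw => exact add_mem hv hw
  | smul x v hmem hv =>
    clear hmem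
    induction hv using Submodule.span_induction with
    | mem v hv =>
      obtain ⟨χ, hχ⟩ := hv
      rw [hχ]
      exact Submodule.smul_mem _ _ (Submodule.subset_span ⟨χ, hχ⟩)
    | zero => simp
    | add v w _ _ hv hw =>
      rw [smul_add]
      exact add_mem hv hw
    | smul c v _ hv =>
      rw [smul_comm]
      exact Submodule.smul_mem _ _ hv

theorem isSemisimpleModule_of_span_eigenvectors
    (h : Submodule.span H (eigenvectors H V) = ⊤) : IsSemisimpleModule H V := by
  rw [← sSup_simples_eq_top_iff_isSemisimpleModule, eq_top_iff, ← h, Submodule.span_le]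
  rintro v ⟨χ, hχ⟩
  by_cases hv : v = 0
  · rw [hv]
    exact zero_mem _
  have hatom : IsAtom (Submodule.span H {v}) := by
    refine ⟨by simpa using hv, fun N hN => (Submodule.eq_bot_iff _).2 fun n hn => ?_⟩
    obtain ⟨x, rfl⟩ := Submodule.mem_span_singleton.1 (hN.le hn)
    rw [hχ] at hn ⊢
    by_contra h0
    have hx : χ x ≠ 0 := fun hx => h0 (by rw [hx, zero_smul])
    have hvN := Submodule.smul_of_tower_mem N (χ x)⁻¹ hn
    rw [smul_smul, inv_mul_cancel₀ hx, one_smul] at hvN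
    exact hN.not_ge (Submodule.span_le.2 (Set.singleton_subset_iff.2 hvN))
  exact (le_sSup (a := Submodule.span H {v}) (isSimpleModule_iff_isAtom.2 hatom))
    (Submodule.mem_span_singleton_self v)

theorem finrank_simple_subquotient_of_finrank_eq_two (hV : Module.finrank ℂ V = 2)
    {W : Submodule H V} (hW : Module.finrank ℂ W = 1) (A B : Submodule H V) (hAB : A ≤ B)
    (hs : IsSimpleModule H (B ⧸ A.comap B.subtype)) :
    Module.finrank ℂ (B ⧸ A.comap B.subtype) = 1 := by
  have : FiniteDimensional ℂ V := Module.finite_of_finrank_pos (by omega)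
  have hfB : FiniteDimensional ℂ B := FiniteDimensional.finiteDimensional_submodule
    (B.restrictScalars ℂ)
  set C := A.comap B.subtype with hC
  have h1 : Module.finrank ℂ (B ⧸ C) + Module.finrank ℂ C = Module.finrank ℂ B := by
    rw [← (Submodule.Quotient.restrictScalarsEquiv ℂ C).finrank_eq]
    exact (C.restrictScalars ℂ).finrank_quotient_add_finrank
  have h2 : Module.finrank ℂ B ≤ 2 := hV ▸ (B.restrictScalars ℂ).finrank_le
  have hnt := IsSimpleModule.nontrivial H (B ⧸ C)
  have hfQ : FiniteDimensional ℂ (B ⧸ C) :=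
    Module.Finite.equiv (Submodule.Quotient.restrictScalarsEquiv ℂ C)
  have h3 : 0 < Module.finrank ℂ (B ⧸ C) := Module.finrank_pos
  by_contra hne
  have hB : B = ⊤ := (Submodule.restrictScalars_eq_top_iff ℂ H V).1
    (Submodule.eq_top_of_finrank_eq (S := B.restrictScalars ℂ)
      (show Module.finrank ℂ B = Module.finrank ℂ V by omega))
  have hC0 : C = ⊥ := (Submodule.restrictScalars_eq_bot_iff ℂ H B).1
    (Submodule.finrank_eq_zero.1 (show Module.finrank ℂ C = 0 by omega))
  have hA : A = ⊥ := by
    have := Submodule.disjoint_iff_comap_eq_bot.2 hC0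
    exact this.symm.eq_bot_of_le hAB
  have hcov := (covBy_iff_quot_is_simple hAB).2 hs
  subst hA hB
  refine hcov.2 (c := W) (bot_lt_iff_ne_bot.2 ?_) (lt_top_iff_ne_top.2 ?_)
  · rintro rfl
    rw [Module.finrank_zero_of_subsingleton] at hW
    exact zero_ne_one hW
  · rintro rfl
    have : Module.finrank ℂ (⊤ : Submodule H V) = Module.finrank ℂ V := finrank_top ℂ V
    omega

variable [FiniteDimensional ℂ H] {p q : ℕ}

/-- A vector which is an eigenvector modulo the span of all eigenvectors lies in that span. -/
theorem mem_span_eigenvectors_of_forall_sub_mem (hp : p.Prime) (hq : q.Prime) (hpq : p ≠ q)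
    (hdim : Module.finrank ℂ H = p * q) [FiniteDimensional ℂ V] {b : V} (ψ : H →ₐ[ℂ] ℂ)
    (hb : ∀ x : H, x • b - ψ x • b ∈ Submodule.span ℂ (eigenvectors H V)) :
    b ∈ Submodule.span ℂ (eigenvectors H V) := by
  have := IsScalarTower.to_smulCommClass' (R := ℂ) (A := H) (M := V)
  obtain ⟨t, ht, hspan, hli⟩ := exists_linearIndependent ℂ (eigenvectors H V)
  have hfin : Finite t := hli.finite
  have := Fintype.ofFinite t
  choose χ hχ using fun s : t => ht s.2
  let B := Module.Basis.span hli
  have hB : ∀ s, (B s : V) = s := fun s => congrArg Subtype.val (Module.Basis.span_apply hli s)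
  have hrange : Submodule.span ℂ (Set.range (Subtype.val : t → V)) =
      Submodule.span ℂ (eigenvectors H V) := by rw [Subtype.range_coe, hspan]
  let F₀ : H →ₗ[ℂ] V := (LinearMap.toSpanSingleton H V b).restrictScalars ℂ -
    LinearMap.toSpanSingleton ℂ V b ∘ₗ ψ.toLinearMap
  let F := F₀.codRestrict (Submodule.span ℂ (Set.range (Subtype.val : t → V))) fun x => by
    rw [hrange]
    exact hb x
  have hF : ∀ x, x • b = ψ x • b + ∑ s, B.coord s (F x) • (s : V) := fun x => by
    have h1 := congrArg Subtype.val (B.sum_repr (F x))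
    simp only [AddSubmonoidClass.coe_finsetSum, Submodule.coe_smul, hB] at h1
    have h2 : (F x : V) = x • b - ψ x • b := rfl
    simp only [Module.Basis.coord_apply]
    rw [h1, h2]
    abel
  have hcoc : ∀ s x y, B.coord s (F (x * y)) =
      χ s x * B.coord s (F y) + B.coord s (F x) * ψ y := by
    intro s x y
    have hxy : F (x * y) = ∑ s, (χ s x * B.coord s (F y)) • B s + ψ y • F x := by
      refine Subtype.ext ?_
      have h1 : (F (x * y) : V) = (x * y) • b - ψ (x * y) • b := rfl
      have h2 : (F x : V) = x • b - ψ x • b := rfl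
      rw [Submodule.coe_add, Submodule.coe_smul, h1, h2, mul_smul, hF y, smul_add, smul_comm x,
        Finset.smul_sum, map_mul]
      simp only [AddSubmonoidClass.coe_finsetSum, Submodule.coe_smul, hB, smul_comm x, hχ,
        smul_smul, smul_sub, mul_comm (χ _ x), mul_comm (ψ x)]
      abel
    classical
    rw [hxy]
    simp only [map_add, map_sum, map_smul, Module.Basis.coord_apply, Module.Basis.repr_self,
      Finsupp.single_apply, smul_eq_mul, mul_ite, mul_one, mul_zero, Finset.sum_ite_eq',
      Finset.mem_univ, if_true]
    rw [mul_comm (ψ y)]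
  choose c hc using fun s => exists_eq_smul_sub_of_mul hp hq hpq hdim (χ s) ψ
    (B.coord s ∘ₗ F) (hcoc s)
  have hsum : ∑ s, c s • (s : V) ∈ Submodule.span ℂ (eigenvectors H V) :=
    sum_mem fun s _ => Submodule.smul_mem _ _ (Submodule.subset_span (ht s.2))
  have hb' : b - ∑ s, c s • (s : V) ∈ eigenvectors H V := by
    refine ⟨ψ, fun x => ?_⟩
    have h1 : ∀ s, B.coord s (F x) = c s * (χ s x - ψ x) := fun s => hc s x
    rw [smul_sub, hF, Finset.smul_sum, smul_sub, Finset.smul_sum, add_sub_assoc,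
      ← Finset.sum_sub_distrib, sub_eq_add_neg, ← Finset.sum_neg_distrib]
    congr 1
    refine Finset.sum_congr rfl fun s _ => ?_
    rw [smul_comm x, hχ, h1]
    module
  have := add_mem (Submodule.subset_span hb') hsum
  rwa [sub_add_cancel] at this

theorem isSemisimpleModule_of_finrank_simple_subquotient (hp : p.Prime) (hq : q.Prime)
    (hpq : p ≠ q) (hdim : Module.finrank ℂ H = p * q) [FiniteDimensional ℂ V]
    (h : ∀ A B : Submodule H V, A ≤ B → IsSimpleModule H (B ⧸ A.comap B.subtype) →
      Module.finrank ℂ (B ⧸ A.comap B.subtype) = 1) : IsSemisimpleModule H V := by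
  refine isSemisimpleModule_of_span_eigenvectors ?_
  by_contra hne
  have := isArtinian_of_tower ℂ (inferInstance : IsArtinian ℂ V) (S := H)
  set S := Submodule.span H (eigenvectors H V) with hS
  obtain ⟨B, hB⟩ := exists_covBy_of_wellFoundedLT (a := S) (by rwa [isMax_iff_eq_top])
  obtain ⟨b, hbB, hbS⟩ := Set.exists_of_ssubset hB.lt
  have h1 := h S B hB.le ((covBy_iff_quot_is_simple hB.le).1 hB)
  set e : B ⧸ S.comap B.subtype := Submodule.Quotient.mk ⟨b, hbB⟩ with he
  have he0 : e ≠ 0 := fun h0 => hbS ((Submodule.Quotient.mk_eq_zero (S.comap B.subtype)).1 h0)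
  obtain ⟨ψ, hψ⟩ := exists_character_of_forall_smul_eq (H := H) he0 fun x => by
    obtain ⟨c, hc⟩ := (finrank_eq_one_iff_of_nonzero' e he0).1 h1 (x • e)
    exact ⟨c, hc.symm⟩
  have hmem : b ∈ Submodule.span ℂ (eigenvectors H V) := by
    refine mem_span_eigenvectors_of_forall_sub_mem hp hq hpq hdim ψ fun x => ?_
    refine mem_span_of_mem_span_eigenvectors (H := H) ?_
    have h2 : Submodule.Quotient.mk (p := S.comap B.subtype) (x • (⟨b, hbB⟩ : B)) =
      Submodule.Quotient.mk (ψ x • (⟨b, hbB⟩ : B)) := hψ x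
    exact (Submodule.Quotient.eq (S.comap B.subtype)).1 h2
  exact hbS (Submodule.span_le_restrictScalars ℂ H _ hmem)

end Modules

/-- For a non-semisimple Hopf algebra `H` of dimension `p·q` over `ℂ` (`p < q` primes):
every extension of one-dimensional `H`-modules splits, and consequently every
finite-dimensional `H`-module all of whose composition factors (i.e. simple
subquotients) are 1-dimensional is semisimple. -/
theorem one_dim_extensions_split (p q : ℕ) (hp : p.Prime) (hq : q.Prime) (hpq : p < q)
    (H : Type) [Ring H] [HopfAlgebra ℂ H]
    (hdim : Module.finrank ℂ H = p * q)
    (hns : ¬ IsSemisimpleRing H) :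
    (∀ (V : Type) [AddCommGroup V] [Module ℂ V] [Module H V] [IsScalarTower ℂ H V],
      Module.finrank ℂ V = 2 →
      ∀ W : Submodule H V, Module.finrank ℂ W = 1 →
        ∃ W' : Submodule H V, W ⊓ W' = ⊥ ∧ W ⊔ W' = ⊤) ∧
    (∀ (V : Type) [AddCommGroup V] [Module ℂ V] [Module H V] [IsScalarTower ℂ H V],
      FiniteDimensional ℂ V →
      (∀ (A B : Submodule H V), A ≤ B →
        IsSimpleModule H (↥B ⧸ Submodule.comap B.subtype A) →
        Module.finrank ℂ (↥B ⧸ Submodule.comap B.subtype A) = 1) →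
      IsSemisimpleModule H V) := by
  have : FiniteDimensional ℂ H :=
    Module.finite_of_finrank_pos (hdim ▸ Nat.mul_pos hp.pos hq.pos)
  refine ⟨fun V _ _ _ _ hV W hW => ?_, fun V _ _ _ _ _ h =>
    isSemisimpleModule_of_finrank_simple_subquotient hp hq hpq.ne hdim h⟩
  have : FiniteDimensional ℂ V := Module.finite_of_finrank_pos (by omega)
  have := isSemisimpleModule_of_finrank_simple_subquotient hp hq hpq.ne hdim
    (finrank_simple_subquotient_of_finrank_eq_two hV hW)
  obtain ⟨W', hW'⟩ := exists_isCompl W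
  exact ⟨W', hW'.inf_eq_bot, hW'.sup_eq_top⟩
end
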